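/- Let Ω be the open unit disk in ℝ², let W ∈ C¹((−∞,1],ℝ) satisfy W(0)=0, W(t)>0 for all t ∈ (−∞,1]\{0}, and W strictly convex, let k ∈ ℤ\{0}, and let u_bd(cos φ, sin φ) = (cos(kφ), sin(kφ), 0) ∈ ℝ³. Let ε_k > 0 be the critical value such that the radial ODE system admits a solution (f_ε, g_ε) with g_ε > 0 exactly for ε ∈ (0, ε_k). Then for every ε ∈ (0, ε_k), the energy E_ε has exactly two minimisers over 𝒜, given by u_ε^±(r cos φ, r sin φ) = f_ε(r)(cos(kφ), sin(kφ), 0) ± g_ε(r)(0,0,1) with g_ε > 0, while the critical point of E_ε corresponding to the solution (f̃_ε, g̃_ε ≡ 0) via the same representation is unstable (its second variation is negative in some direction in H¹₀(Ω;ℝ³)). -/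

import Mathlib

open MeasureTheory Set Bornology

noncomputable section

/-- Euclidean dot product on `Fin n → ℝ`. -/
def dotR {n : ℕ} (a b : Fin n → ℝ) : ℝ := ∑ j, a j * b j

/-- Squared Euclidean norm on `Fin n → ℝ`. -/
def normSq {n : ℕ} (a : Fin n → ℝ) : ℝ := ∑ j, a j ^ 2

/-- Pointwise (Frobenius) inner product of gradients `∇u · ∇v`. -/
def gradDot {m n : ℕ} (u v : (Fin m → ℝ) → Fin n → ℝ) (x : Fin m → ℝ) : ℝ :=
  ∑ i, ∑ j, fderiv ℝ u x (Pi.single i (1:ℝ)) j * fderiv ℝ v x (Pi.single i (1:ℝ)) j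

/-- `|∇u|²`. -/
def gradSq {m n : ℕ} (u : (Fin m → ℝ) → Fin n → ℝ) (x : Fin m → ℝ) : ℝ := gradDot u u x

/-- Scalar version of `gradDot`. -/
def gradDotS {m : ℕ} (φ ψ : (Fin m → ℝ) → ℝ) (x : Fin m → ℝ) : ℝ :=
  ∑ i, fderiv ℝ φ x (Pi.single i (1:ℝ)) * fderiv ℝ ψ x (Pi.single i (1:ℝ))

/-- `|∇φ|²` for scalar `φ`. -/
def gradSqS {m : ℕ} (φ : (Fin m → ℝ) → ℝ) (x : Fin m → ℝ) : ℝ := gradDotS φ φ x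

/-- `W'`, the (one-sided) derivative of the potential on `(-∞, 1]`. -/
def Wd (W : ℝ → ℝ) : ℝ → ℝ := derivWithin W (Iic (1:ℝ))

/-- The Ginzburg–Landau energy `E_ε`. -/
def GLenergy {m n : ℕ} (W : ℝ → ℝ) (ε : ℝ) (Ω : Set (Fin m → ℝ))
    (u : (Fin m → ℝ) → Fin n → ℝ) : ℝ :=
  ∫ x in Ω, (gradSq u x / 2 + W (1 - normSq (u x)) / (2 * ε ^ 2))

/-- The admissible class `𝒜`: `H¹` maps attaining the boundary data `ubd` on `∂Ω`. -/
def Admissible {m n : ℕ} (Ω : Set (Fin m → ℝ)) (ubd u : (Fin m → ℝ) → Fin n → ℝ) : Prop :=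
  ContDiffOn ℝ 1 u Ω ∧ ContinuousOn u (closure Ω) ∧
  IntegrableOn (gradSq u) Ω ∧ IntegrableOn (fun x => normSq (u x)) Ω ∧
  EqOn u ubd (frontier Ω)

/-- `H¹₀(Ω; ℝⁿ)`. -/
def H10 {m n : ℕ} (Ω : Set (Fin m → ℝ)) (v : (Fin m → ℝ) → Fin n → ℝ) : Prop :=
  ContDiffOn ℝ 1 v Ω ∧ ContinuousOn v (closure Ω) ∧
  IntegrableOn (gradSq v) Ω ∧ IntegrableOn (fun x => normSq (v x)) Ω ∧
  EqOn v 0 (frontier Ω)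

/-- `H¹₀(Ω; ℝ)`. -/
def H10S {m : ℕ} (Ω : Set (Fin m → ℝ)) (φ : (Fin m → ℝ) → ℝ) : Prop :=
  ContDiffOn ℝ 1 φ Ω ∧ ContinuousOn φ (closure Ω) ∧
  IntegrableOn (gradSqS φ) Ω ∧ IntegrableOn (fun x => φ x ^ 2) Ω ∧
  EqOn φ 0 (frontier Ω)

/-- Critical point of `E_ε`: weak solution of `-Δu = ε⁻² u W'(1-|u|²)` in `Ω`. -/
def IsCritical {m n : ℕ} (W : ℝ → ℝ) (ε : ℝ) (Ω : Set (Fin m → ℝ))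
    (u : (Fin m → ℝ) → Fin n → ℝ) : Prop :=
  ∀ v, H10 Ω v →
    (∫ x in Ω, (gradDot u v x - 1 / ε ^ 2 * Wd W (1 - normSq (u x)) * dotR (u x) (v x))) = 0

/-- Minimiser of `E_ε` over `𝒜`. -/
def IsMinimiser {m n : ℕ} (W : ℝ → ℝ) (ε : ℝ) (Ω : Set (Fin m → ℝ))
    (ubd u : (Fin m → ℝ) → Fin n → ℝ) : Prop :=
  Admissible Ω ubd u ∧ ∀ v, Admissible Ω ubd v → GLenergy W ε Ω u ≤ GLenergy W ε Ω v

/-- Orthogonal transformation of `ℝⁿ` (element of `O(n)`). -/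
def IsOrth {n : ℕ} (R : (Fin n → ℝ) →ₗ[ℝ] (Fin n → ℝ)) : Prop :=
  Function.Bijective R ∧ ∀ a b, dotR (R a) (R b) = dotR a b

/-- The radial ODE system \eqref{syst:ode}-\eqref{syst:bc} for the profiles `(f, g)`. -/
def SolvesSystem (W : ℝ → ℝ) (ε : ℝ) (k : ℤ) (f g : ℝ → ℝ) : Prop :=
  ContinuousOn f (Icc 0 1) ∧ ContinuousOn g (Icc 0 1) ∧
  ContDiffOn ℝ 2 f (Ioo 0 1) ∧ ContDiffOn ℝ 2 g (Ioo 0 1) ∧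
  (∀ r ∈ Ioo (0:ℝ) 1,
    -deriv (deriv f) r - 1 / r * deriv f r + (k : ℝ) ^ 2 / r ^ 2 * f r
      = 1 / ε ^ 2 * f r * Wd W (1 - f r ^ 2 - g r ^ 2)) ∧
  (∀ r ∈ Ioo (0:ℝ) 1,
    -deriv (deriv g) r - 1 / r * deriv g r
      = 1 / ε ^ 2 * g r * Wd W (1 - f r ^ 2 - g r ^ 2)) ∧
  f 0 = 0 ∧ f 1 = 1 ∧ derivWithin g (Icc 0 1) 0 = 0 ∧ g 1 = 0

/-- The open unit disk in `ℝ²`. -/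
def unitDisk : Set (Fin 2 → ℝ) := {x | x 0 ^ 2 + x 1 ^ 2 < 1}

/-- The boundary data of winding number `k`:
`u_bd (cos φ, sin φ) = (cos (k φ), sin (k φ), 0)`. -/
def ubdDeg (k : ℤ) (x : Fin 2 → ℝ) : Fin 3 → ℝ :=
  ![Real.cos ((k : ℝ) * Complex.arg ((x 0 : ℂ) + (x 1 : ℂ) * Complex.I)),
    Real.sin ((k : ℝ) * Complex.arg ((x 0 : ℂ) + (x 1 : ℂ) * Complex.I)), 0]

/-- The rotationally symmetric map with radial profiles `(f, s • g)`:
`(r cos φ, r sin φ) ↦ (f r cos (k φ), f r sin (k φ), s · g r)`. -/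
def radialMap (k : ℤ) (f g : ℝ → ℝ) (s : ℝ) (x : Fin 2 → ℝ) : Fin 3 → ℝ :=
  ![f (Real.sqrt (normSq x)) * Real.cos ((k : ℝ) * Complex.arg ((x 0 : ℂ) + (x 1 : ℂ) * Complex.I)),
    f (Real.sqrt (normSq x)) * Real.sin ((k : ℝ) * Complex.arg ((x 0 : ℂ) + (x 1 : ℂ) * Complex.I)),
    s * g (Real.sqrt (normSq x))]

section

open Filter Topology

/-- The linear radial equation `-f'' - f'/r + m² f/r² = c f` on `(0, 1)`, with continuous data. -/
structure RadialODE (m : ℕ) (c f : ℝ → ℝ) : Prop where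
  continuousOn : ContinuousOn f (Icc 0 1)
  continuousOn_coeff : ContinuousOn c (Icc 0 1)
  contDiffOn : ContDiffOn ℝ 2 f (Ioo 0 1)
  ode : ∀ r ∈ Ioo (0:ℝ) 1,
    -deriv (deriv f) r - 1 / r * deriv f r + (m : ℝ) ^ 2 / r ^ 2 * f r = c r * f r
  zero : m ≠ 0 → f 0 = 0

/-- The combination `f' - m f / r`. -/
def radialFlux (m : ℕ) (f : ℝ → ℝ) (r : ℝ) : ℝ := deriv f r - m * f r / r

namespace RadialODE

variable {m : ℕ} {c f : ℝ → ℝ}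

theorem hasDerivAt (h : RadialODE m c f) {r : ℝ} (hr : r ∈ Ioo (0:ℝ) 1) :
    HasDerivAt f (deriv f r) r :=
  ((h.contDiffOn.differentiableOn (by norm_num)).differentiableAt
    (isOpen_Ioo.mem_nhds hr)).hasDerivAt

theorem hasDerivAt_deriv (h : RadialODE m c f) {r : ℝ} (hr : r ∈ Ioo (0:ℝ) 1) :
    HasDerivAt (deriv f) (deriv (deriv f) r) r := by
  have h1 : ContDiffOn ℝ 1 (deriv f) (Ioo 0 1) :=
    ((contDiffOn_succ_iff_deriv_of_isOpen (n := 1) isOpen_Ioo).1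
      (by simpa [one_add_one_eq_two] using h.contDiffOn)).2.2
  exact ((h1.differentiableOn (by norm_num)).differentiableAt
    (isOpen_Ioo.mem_nhds hr)).hasDerivAt

theorem hasDerivAt_radialFlux (h : RadialODE m c f) {r : ℝ} (hr : r ∈ Ioo (0:ℝ) 1) :
    HasDerivAt (radialFlux m f) (-(m + 1) / r * radialFlux m f r - c r * f r) r := by
  have hr0 : r ≠ 0 := hr.1.ne'
  have := (h.hasDerivAt_deriv hr).sub
    (((h.hasDerivAt hr).const_mul (m : ℝ)).div (hasDerivAt_id r) hr0)
  refine this.congr_deriv ?_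
  have ode := h.ode r hr
  unfold radialFlux
  rw [← ode]
  simp only [id]
  field_simp
  ring

theorem hasDerivAt_pow_mul_radialFlux (h : RadialODE m c f) {r : ℝ} (hr : r ∈ Ioo (0:ℝ) 1) :
    HasDerivAt (fun r => r ^ (m + 1) * radialFlux m f r) (-(r ^ (m + 1) * (c r * f r))) r := by
  have hr0 : r ≠ 0 := hr.1.ne'
  refine ((hasDerivAt_pow (m + 1) r).mul (h.hasDerivAt_radialFlux hr)).congr_deriv ?_
  push_cast
  field_simp
  ring

theorem exists_small_flux (h : RadialODE m c f) {r η : ℝ} (hr : r ∈ Ioo (0:ℝ) 1) (hη : 0 < η) :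
    ∃ s ∈ Ioo 0 r, |s ^ (m + 1) * radialFlux m f s| ≤ (4 + m) * η := by
  have hc := h.continuousOn 0 (by simp)
  rw [Metric.continuousWithinAt_iff] at hc
  obtain ⟨δ, hδ, hf⟩ := hc η hη
  simp only [Real.dist_eq] at hf
  obtain ⟨t, ht0, ht⟩ : ∃ t, 0 < t ∧ 2 * t < min δ r := by
    refine ⟨min δ r / 4, by have := lt_min hδ hr.1; linarith, ?_⟩
    have := lt_min hδ hr.1; linarith
  have htδ := lt_of_lt_of_le ht (min_le_left _ _)
  have htr := lt_of_lt_of_le ht (min_le_right _ _)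
  have hr1 := hr.2
  have hsmall : ∀ s ∈ Icc t (2 * t), |f s - f 0| < η := fun s hs => by
    refine hf ⟨by linarith [hs.1], by linarith [hs.2]⟩ ?_
    rw [sub_zero, abs_of_pos (by linarith [hs.1])]; linarith [hs.2]
  obtain ⟨s, hs, hs'⟩ := exists_hasDerivAt_eq_slope f (deriv f) (show t < 2 * t by linarith)
    (h.continuousOn.mono fun x hx => ⟨by linarith [hx.1], by linarith [hx.2]⟩)
    (fun x hx => h.hasDerivAt ⟨by linarith [hx.1], by linarith [hx.2]⟩)
  have hs0 : 0 < s := by linarith [hs.1]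
  have hs1 : s < 1 := by linarith [hs.2]
  refine ⟨s, ⟨hs0, by linarith [hs.2]⟩, ?_⟩
  have hsf : |s * deriv f s| ≤ 4 * η := by
    have e : t * deriv f s = f (2 * t) - f t := by
      rw [hs']; field_simp; ring
    have h1 := abs_lt.1 (hsmall t ⟨le_refl _, by linarith⟩)
    have h2 := abs_lt.1 (hsmall (2 * t) ⟨by linarith, le_refl _⟩)
    have h3 : |t * deriv f s| ≤ 2 * η := by
      rw [e, abs_le]; constructor <;> linarith
    rw [abs_mul, abs_of_pos ht0] at h3
    rw [abs_mul, abs_of_pos hs0]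
    nlinarith [abs_nonneg (deriv f s), hs.2]
  have hmf : |(m : ℝ) * f s| ≤ m * η := by
    rcases eq_or_ne m 0 with rfl | hm
    · simp
    · have := hsmall s ⟨hs.1.le, hs.2.le⟩
      rw [h.zero hm, sub_zero] at this
      rw [abs_mul, Nat.abs_cast]
      exact mul_le_mul_of_nonneg_left this.le (Nat.cast_nonneg _)
  have e : s ^ (m + 1) * radialFlux m f s = s ^ m * (s * deriv f s - m * f s) := by
    unfold radialFlux; field_simp; ring
  rw [e, abs_mul, abs_of_pos (pow_pos hs0 m)]
  have hle : |s * deriv f s - m * f s| ≤ (4 + m) * η := by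
    refine (abs_sub _ _).trans ?_
    linarith
  calc s ^ m * |s * deriv f s - m * f s| ≤ 1 * |s * deriv f s - m * f s| :=
        mul_le_mul_of_nonneg_right (pow_le_one₀ hs0.le hs1.le) (abs_nonneg _)
    _ ≤ _ := by rw [one_mul]; exact hle

theorem abs_radialFlux_le (h : RadialODE m c f) {R N : ℝ} (hR : R ≤ 1)
    (hN : ∀ r ∈ Ioo 0 R, |c r * f r| ≤ N) {r : ℝ} (hr : r ∈ Ioo 0 R) :
    |radialFlux m f r| ≤ N * r := by
  have hr' : r ∈ Ioo (0:ℝ) 1 := ⟨hr.1, hr.2.trans_le hR⟩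
  have hN0 : 0 ≤ N := (abs_nonneg _).trans (hN r hr)
  have key : |r ^ (m + 1) * radialFlux m f r| ≤ N * r ^ (m + 2) := by
    refine le_of_forall_pos_le_add fun η hη => ?_
    have hm : (0:ℝ) < 4 + m := by positivity
    obtain ⟨s, hs, hs'⟩ := h.exists_small_flux hr' (div_pos hη hm)
    rw [mul_div_cancel₀ _ hm.ne'] at hs'
    have := Convex.norm_image_sub_le_of_norm_hasDerivWithin_le
      (f := fun r => r ^ (m + 1) * radialFlux m f r) (C := r ^ (m + 1) * N) (s := Icc s r)
      (fun x hx => (h.hasDerivAt_pow_mul_radialFlux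
        ⟨hs.1.trans_le hx.1, hx.2.trans_lt hr'.2⟩).hasDerivWithinAt)
      (fun x hx => by
        have hx0 : 0 < x := hs.1.trans_le hx.1
        rw [norm_neg, Real.norm_eq_abs, abs_mul, abs_of_pos (pow_pos hx0 _)]
        exact mul_le_mul (pow_le_pow_left₀ hx0.le hx.2 _) (hN x ⟨hx0, hx.2.trans_lt hr.2⟩)
          (abs_nonneg _) (pow_nonneg hr.1.le _))
      (convex_Icc s r) (left_mem_Icc.2 hs.2.le) (right_mem_Icc.2 hs.2.le)
    rw [Real.norm_eq_abs, Real.norm_eq_abs, abs_of_pos (sub_pos.2 hs.2)] at this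
    have h1 : r ^ (m + 1) * N * (r - s) ≤ N * r ^ (m + 2) := by
      have : r ^ (m + 1) * N * (r - s) ≤ r ^ (m + 1) * N * r :=
        mul_le_mul_of_nonneg_left (by linarith [hs.1])
          (mul_nonneg (pow_nonneg hr.1.le _) hN0)
      refine this.trans (le_of_eq ?_); ring
    have h2 := abs_sub_abs_le_abs_sub (r ^ (m + 1) * radialFlux m f r)
      (s ^ (m + 1) * radialFlux m f s)
    linarith
  rw [abs_mul, abs_of_pos (pow_pos hr.1 _)] at key
  have hp := pow_pos hr.1 (m + 1)
  have : r ^ (m + 1) * |radialFlux m f r| ≤ r ^ (m + 1) * (N * r) := by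
    refine key.trans (le_of_eq ?_); ring
  exact le_of_mul_le_mul_left this hp

theorem exists_abs_mul_le (h : RadialODE m c f) :
    ∃ N, 0 ≤ N ∧ ∀ r ∈ Icc (0:ℝ) 1, |c r * f r| ≤ N := by
  obtain ⟨N, hN⟩ := isCompact_Icc.exists_bound_of_continuousOn
    (h.continuousOn_coeff.mul h.continuousOn)
  exact ⟨N, (norm_nonneg _).trans (hN 0 (by simp)), hN⟩

theorem exists_abs_radialFlux_le (h : RadialODE m c f) :
    ∃ N, 0 ≤ N ∧ ∀ r ∈ Ioo (0:ℝ) 1, |radialFlux m f r| ≤ N * r := by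
  obtain ⟨N, hN0, hN⟩ := h.exists_abs_mul_le
  exact ⟨N, hN0, fun r hr =>
    h.abs_radialFlux_le le_rfl (fun s hs => hN s (Ioo_subset_Icc_self hs)) hr⟩

theorem hasDerivAt_div_pow (h : RadialODE m c f) {r : ℝ} (hr : r ∈ Ioo (0:ℝ) 1) :
    HasDerivAt (fun r => f r / r ^ m) (radialFlux m f r / r ^ m) r := by
  have hr0 : r ≠ 0 := hr.1.ne'
  refine ((h.hasDerivAt hr).div (hasDerivAt_pow m r) (pow_ne_zero _ hr0)).congr_deriv ?_
  unfold radialFlux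
  rcases m with _ | m
  · simp
  · simp only [add_tsub_cancel_right]
    field_simp
    ring

theorem tendsto_div_of_one (h : RadialODE 1 c f) :
    ∃ a, Tendsto (fun r => f r / r) (𝓝[>] 0) (𝓝 a) := by
  obtain ⟨N, hN0, hN⟩ := h.exists_abs_radialFlux_le
  have hL : LipschitzOnWith N.toNNReal (fun r => f r / r) (Ioo 0 1) := by
    refine Convex.lipschitzOnWith_of_nnnorm_hasDerivWithin_le (convex_Ioo 0 1)
      (f' := fun r => radialFlux 1 f r / r) (fun r hr => ?_) fun r hr => ?_
    · simpa using (h.hasDerivAt_div_pow hr).hasDerivWithinAt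
    · rw [← NNReal.coe_le_coe, coe_nnnorm, Real.norm_eq_abs, abs_div, abs_of_pos hr.1,
        div_le_iff₀ hr.1, Real.coe_toNNReal _ hN0]
      exact hN r hr
  obtain ⟨g, hg, hfg⟩ := hL.extend_real
  refine ⟨g 0, ?_⟩
  refine ((hg.continuous.tendsto 0).mono_left nhdsWithin_le_nhds).congr' ?_
  filter_upwards [Ioo_mem_nhdsGT (zero_lt_one' ℝ)] with r hr using (hfg hr).symm

theorem tendsto_div_of_two_le (h : RadialODE m c f) (hm : 2 ≤ m) :
    Tendsto (fun r => f r / r) (𝓝[>] 0) (𝓝 0) := by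
  obtain ⟨n, rfl⟩ : ∃ n, m = n + 2 := ⟨m - 2, by omega⟩
  obtain ⟨N, hN0, hN⟩ := h.exists_abs_radialFlux_le
  have bound : ∀ R ∈ Ioo (0:ℝ) 1, ∀ r ∈ Ioo 0 R,
      |f r / r| ≤ |f R / R ^ (n + 2)| * r + N * R := by
    intro R hR r hr
    have hr0 := hr.1
    have hI : ∀ x ∈ Icc r R, x ∈ Ioo (0:ℝ) 1 := fun x hx =>
      ⟨hr.1.trans_le hx.1, hx.2.trans_lt hR.2⟩
    have hq : ∀ x ∈ Icc r R, HasDerivAt (fun x : ℝ => (x ^ (n + 1))⁻¹)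
        (-((n + 1) / x ^ (n + 2))) x := fun x hx => by
      have hx0 : x ≠ 0 := (hI x hx).1.ne'
      refine ((hasDerivAt_pow (n + 1) x).inv (pow_ne_zero _ hx0)).congr_deriv ?_
      push_cast
      field_simp
      ring
    obtain ⟨ξ, hξ, e⟩ := exists_ratio_hasDerivAt_eq_ratio_slope
      (fun x => f x / x ^ (n + 2)) (fun x => radialFlux (n + 2) f x / x ^ (n + 2)) hr.2
      (fun x hx => (h.hasDerivAt_div_pow (hI x hx)).continuousAt.continuousWithinAt)
      (fun x hx => h.hasDerivAt_div_pow (hI x (Ioo_subset_Icc_self hx)))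
      (fun x : ℝ => (x ^ (n + 1))⁻¹) (fun x => -((n + 1) / x ^ (n + 2)))
      (fun x hx => (hq x hx).continuousAt.continuousWithinAt)
      (fun x hx => hq x (Ioo_subset_Icc_self hx))
    have hξ0 : 0 < ξ := hr.1.trans hξ.1
    have hξp := pow_pos hξ0 (n + 2)
    have e' : ((r ^ (n + 1))⁻¹ - (R ^ (n + 1))⁻¹) * radialFlux (n + 2) f ξ
        = (f R / R ^ (n + 2) - f r / r ^ (n + 2)) * (n + 1) := by
      field_simp at e ⊢
      linarith
    have hb : |radialFlux (n + 2) f ξ| ≤ N * R :=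
      (hN ξ ⟨hξ0, hξ.2.trans hR.2⟩).trans (mul_le_mul_of_nonneg_left hξ.2.le hN0)
    have hd0 : 0 ≤ (r ^ (n + 1))⁻¹ - (R ^ (n + 1))⁻¹ :=
      sub_nonneg.2 (inv_anti₀ (pow_pos hr0 _) (pow_le_pow_left₀ hr0.le hr.2.le _))
    have hRi : 0 ≤ (R ^ (n + 1))⁻¹ := by have := hR.1; positivity
    have h1 : |f R / R ^ (n + 2) - f r / r ^ (n + 2)| ≤ (r ^ (n + 1))⁻¹ * (N * R) := by
      have h2 : |f R / R ^ (n + 2) - f r / r ^ (n + 2)| * (n + 1) ≤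
          (r ^ (n + 1))⁻¹ * (N * R) := by
        have : (0:ℝ) ≤ n + 1 := by positivity
        rw [← abs_of_nonneg this, ← abs_mul, ← e', abs_mul, abs_of_nonneg hd0]
        exact mul_le_mul (by linarith) hb (abs_nonneg _) (by positivity)
      refine le_trans (le_mul_of_one_le_right (abs_nonneg _) ?_) h2
      have : (0:ℝ) ≤ n := by positivity
      linarith
    have h3 : |f r / r ^ (n + 2)| ≤ |f R / R ^ (n + 2)| + (r ^ (n + 1))⁻¹ * (N * R) := by
      have := abs_sub_abs_le_abs_sub (f r / r ^ (n + 2)) (f R / R ^ (n + 2))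
      rw [abs_sub_comm] at this
      linarith
    have hp := pow_pos hr0 (n + 1)
    calc |f r / r| = r ^ (n + 1) * |f r / r ^ (n + 2)| := by
          rw [← abs_of_pos hp, ← abs_mul]
          congr 1
          field_simp
          ring
      _ ≤ r ^ (n + 1) * (|f R / R ^ (n + 2)| + (r ^ (n + 1))⁻¹ * (N * R)) :=
          mul_le_mul_of_nonneg_left h3 hp.le
      _ = r ^ (n + 1) * |f R / R ^ (n + 2)| + N * R := by
          field_simp
      _ ≤ |f R / R ^ (n + 2)| * r + N * R := by
          have : r ^ (n + 1) ≤ r := by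
            rw [pow_succ]
            exact mul_le_of_le_one_left hr0.le
              (pow_le_one₀ hr0.le (hr.2.trans hR.2).le)
          rw [mul_comm]
          gcongr
  rw [Metric.tendsto_nhds]
  intro η hη
  obtain ⟨R, hR, hNR⟩ : ∃ R ∈ Ioo (0:ℝ) 1, N * R < η / 2 := by
    refine ⟨min (1 / 2) (η / (4 * (N + 1))), ⟨by positivity, ?_⟩, ?_⟩
    · exact (min_le_left _ _).trans_lt (by norm_num)
    · calc N * min (1 / 2) (η / (4 * (N + 1))) ≤ N * (η / (4 * (N + 1))) :=
            mul_le_mul_of_nonneg_left (min_le_right _ _) hN0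
        _ < η / 2 := by
            rw [mul_div_assoc', div_lt_div_iff₀ (by positivity) (by positivity)]
            nlinarith
  have hlim : Tendsto (fun r => |f R / R ^ (n + 2)| * r + N * R) (𝓝[>] 0) (𝓝 (N * R)) := by
    have : Tendsto (fun r => |f R / R ^ (n + 2)| * r + N * R) (𝓝 0)
        (𝓝 (|f R / R ^ (n + 2)| * 0 + N * R)) :=
      Continuous.tendsto (by fun_prop) 0
    simpa using this.mono_left nhdsWithin_le_nhds
  filter_upwards [hlim.eventually (gt_mem_nhds (show N * R < η by linarith)),
    Ioo_mem_nhdsGT hR.1] with r hr hrR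
  rw [dist_zero_right, Real.norm_eq_abs]
  exact (bound R hR r hrR).trans_lt hr

theorem exists_tendsto_div (h : RadialODE m c f) (hm : m ≠ 0) :
    ∃ a, Tendsto (fun r => f r / r) (𝓝[>] 0) (𝓝 a) ∧ (2 ≤ m → a = 0) := by
  rcases Nat.lt_or_ge m 2 with h2 | h2
  · obtain rfl : m = 1 := by omega
    obtain ⟨a, ha⟩ := h.tendsto_div_of_one
    exact ⟨a, ha, by omega⟩
  · exact ⟨0, h.tendsto_div_of_two_le h2, fun _ => rfl⟩

theorem exists_abs_div_le (h : RadialODE m c f) (hm : m ≠ 0) :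
    ∃ K, 0 ≤ K ∧ ∀ r ∈ Ioo (0:ℝ) 1, |f r / r| ≤ K := by
  obtain ⟨a, ha, -⟩ := h.exists_tendsto_div hm
  obtain ⟨M, hM⟩ := isCompact_Icc.exists_bound_of_continuousOn h.continuousOn
  have hM0 : 0 ≤ M := (norm_nonneg _).trans (hM 0 (by simp))
  have := ha.abs.eventually (gt_mem_nhds (lt_add_one |a|))
  obtain ⟨δ, hδ, hδ'⟩ := (mem_nhdsGT_iff_exists_Ioo_subset).1 this
  have hδ0 : 0 < δ := hδ
  refine ⟨|a| + 1 + M / δ, by positivity, fun r hr => ?_⟩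
  rcases lt_or_ge r δ with hrδ | hrδ
  · have : |f r / r| < |a| + 1 := hδ' ⟨hr.1, hrδ⟩
    have : 0 ≤ M / δ := by positivity
    linarith
  · have : |f r / r| ≤ M / δ := by
      rw [abs_div, abs_of_pos hr.1]
      exact div_le_div₀ hM0 (hM r ⟨hr.1.le, hr.2.le⟩) hδ0 hrδ
    have := abs_nonneg a
    linarith

/-- A nonnegative regular solution that is positive on `(0, 1)` is positive at the centre. -/
theorem pos_zero (h : RadialODE 0 c f) (hpos : ∀ r ∈ Ioo (0:ℝ) 1, 0 < f r) : 0 < f 0 := by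
  have hcl : Tendsto f (𝓝[>] 0) (𝓝 (f 0)) := by
    have h0 := (h.continuousOn 0 (by simp)).tendsto
    rw [← nhdsWithin_Ioo_eq_nhdsGT (zero_lt_one' ℝ)]
    exact h0.mono_left (nhdsWithin_mono _ Ioo_subset_Icc_self)
  have h00 : 0 ≤ f 0 := by
    refine ge_of_tendsto hcl ?_
    filter_upwards [Ioo_mem_nhdsGT (zero_lt_one' ℝ)] with r hr using (hpos r hr).le
  refine lt_of_le_of_ne h00 fun hzero => ?_
  obtain ⟨C, hC⟩ := isCompact_Icc.exists_bound_of_continuousOn h.continuousOn_coeff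
  have hC0 : 0 ≤ C := (norm_nonneg _).trans (hC 0 (by simp))
  obtain ⟨R, hR0, hR1, hCR⟩ : ∃ R : ℝ, 0 < R ∧ R < 1 ∧ C * R < 1 := by
    refine ⟨1 / (C + 2), by positivity, ?_, ?_⟩
    · rw [div_lt_one (by positivity)]; linarith
    · rw [mul_one_div, div_lt_one (by positivity)]; linarith
  obtain ⟨t, ht, hmax⟩ := isCompact_Icc.exists_isMaxOn (nonempty_Icc.2 hR0.le)
    (h.continuousOn.mono (Icc_subset_Icc_right hR1.le))
  have hft : 0 < f t := (hpos (R / 2) ⟨by linarith, by linarith⟩).trans_le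
    (hmax ⟨by linarith, by linarith⟩)
  have ht0 : 0 < t := lt_of_le_of_ne ht.1 fun e => by rw [← e, ← hzero] at hft; exact hft.false
  obtain ⟨s, hs, hs'⟩ := exists_hasDerivAt_eq_slope f (deriv f) ht0
    (h.continuousOn.mono (Icc_subset_Icc_right (ht.2.trans hR1.le)))
    (fun x hx => h.hasDerivAt ⟨hx.1, hx.2.trans_le (ht.2.trans hR1.le)⟩)
  have hb := h.abs_radialFlux_le (R := R) (N := C * f t) hR1.le (fun r hr => by
    have hrI : r ∈ Icc (0:ℝ) 1 := ⟨hr.1.le, (hr.2.trans hR1).le⟩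
    rw [abs_mul, abs_of_pos (hpos r ⟨hr.1, hr.2.trans hR1⟩)]
    exact mul_le_mul (hC r hrI) (hmax ⟨hr.1.le, hr.2.le⟩) (hpos r ⟨hr.1, hr.2.trans hR1⟩).le hC0)
    (r := s) ⟨hs.1, hs.2.trans_le ht.2⟩
  simp only [radialFlux, Nat.cast_zero, zero_mul, zero_div, sub_zero] at hb
  rw [hs', ← hzero, sub_zero, sub_zero, abs_of_pos (div_pos hft ht0), div_le_iff₀ ht0] at hb
  have h1 : C * s * t ≤ C * R := by
    have : s * t ≤ R * 1 := mul_le_mul (hs.2.le.trans ht.2) (ht.2.trans hR1.le) ht0.le hR0.le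
    rw [mul_assoc]
    exact mul_le_mul_of_nonneg_left (by linarith) hC0
  nlinarith

end RadialODE

/-- The Euclidean distance to the origin of the plane. -/
def rad (x : Fin 2 → ℝ) : ℝ := Real.sqrt (normSq x)

/-- The linear form with coefficients `a`, `b`. -/
def gradForm (a b : ℝ) : (Fin 2 → ℝ) →L[ℝ] ℝ :=
  a • ContinuousLinearMap.proj (R := ℝ) (φ := fun _ : Fin 2 => ℝ) 0 +
    b • ContinuousLinearMap.proj (R := ℝ) (φ := fun _ : Fin 2 => ℝ) 1

@[simp] theorem gradForm_apply (a b : ℝ) (v : Fin 2 → ℝ) :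
    gradForm a b v = a * v 0 + b * v 1 := by simp [gradForm]

/-- The point of the plane as a complex number. -/
def toComplex (x : Fin 2 → ℝ) : ℂ := (x 0 : ℂ) + (x 1 : ℂ) * Complex.I

/-- The homogeneous harmonic polynomial `Re (α zᵐ)`. -/
def harm (α : ℂ) (m : ℕ) (x : Fin 2 → ℝ) : ℝ := (α * toComplex x ^ m).re

theorem normSq_two (x : Fin 2 → ℝ) : normSq x = x 0 ^ 2 + x 1 ^ 2 := by
  simp [normSq, Fin.sum_univ_two]

theorem normSq_nonneg {n : ℕ} (x : Fin n → ℝ) : 0 ≤ normSq x :=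
  Finset.sum_nonneg fun _ _ => sq_nonneg _

theorem continuous_normSq {n : ℕ} : Continuous (normSq : (Fin n → ℝ) → ℝ) := by
  unfold normSq; fun_prop

theorem rad_nonneg (x : Fin 2 → ℝ) : 0 ≤ rad x := Real.sqrt_nonneg _

theorem rad_sq (x : Fin 2 → ℝ) : rad x ^ 2 = x 0 ^ 2 + x 1 ^ 2 := by
  rw [rad, Real.sq_sqrt (normSq_nonneg _), normSq_two]

theorem continuous_rad : Continuous rad := Real.continuous_sqrt.comp continuous_normSq

@[simp] theorem rad_zero : rad 0 = 0 := by simp [rad, normSq]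

theorem rad_pos {x : Fin 2 → ℝ} (hx : x ≠ 0) : 0 < rad x := by
  rcases (rad_nonneg x).lt_or_eq with h | h
  · exact h
  · refine absurd ?_ hx
    have h2 := rad_sq x
    rw [← h] at h2
    have h0 : x 0 = 0 := by nlinarith [sq_nonneg (x 0), sq_nonneg (x 1)]
    have h1 : x 1 = 0 := by nlinarith [sq_nonneg (x 0), sq_nonneg (x 1)]
    ext i; fin_cases i <;> simp [h0, h1]

theorem abs_apply_le_rad (x : Fin 2 → ℝ) (i : Fin 2) : |x i| ≤ rad x := by
  refine abs_le_of_sq_le_sq ?_ (rad_nonneg x)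
  rw [rad_sq]
  fin_cases i
  · simpa using sq_nonneg (x 1)
  · simpa using sq_nonneg (x 0)

theorem mem_unitDisk_iff {x : Fin 2 → ℝ} : x ∈ unitDisk ↔ rad x < 1 := by
  have h := rad_sq x
  have h0 := rad_nonneg x
  simp only [unitDisk, mem_ofPred_eq, ← h]
  constructor <;> intro <;> nlinarith

theorem isOpen_unitDisk : IsOpen unitDisk := by
  have : unitDisk = {x | rad x < 1} := by ext; exact mem_unitDisk_iff
  rw [this]
  exact isOpen_lt continuous_rad continuous_const

theorem rad_le_one_of_mem_closure {x : Fin 2 → ℝ} (hx : x ∈ closure unitDisk) : rad x ≤ 1 := by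
  have : closure unitDisk ⊆ {x | rad x ≤ 1} :=
    closure_minimal (fun x hx => (mem_unitDisk_iff.1 hx).le)
      (isClosed_le continuous_rad continuous_const)
  exact this hx

theorem rad_eq_one_of_mem_frontier {x : Fin 2 → ℝ} (hx : x ∈ frontier unitDisk) : rad x = 1 := by
  rw [frontier, isOpen_unitDisk.interior_eq] at hx
  exact le_antisymm (rad_le_one_of_mem_closure hx.1)
    (not_lt.1 fun h => hx.2 (mem_unitDisk_iff.2 h))

theorem unitDisk_subset_Icc : unitDisk ⊆ Icc (-1) 1 := fun x hx => by
  have h := mem_unitDisk_iff.1 hx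
  constructor <;> intro i <;> have h' := abs_le.1 ((abs_apply_le_rad x i).trans h.le)
  · simpa using h'.1
  · simpa using h'.2

theorem isCompact_closure_unitDisk : IsCompact (closure unitDisk) :=
  isCompact_Icc.of_isClosed_subset isClosed_closure
    (closure_minimal unitDisk_subset_Icc isClosed_Icc)

theorem convex_unitDisk : Convex ℝ unitDisk := by
  intro x hx y hy a b ha hb hab
  simp only [unitDisk, mem_ofPred_eq, Pi.add_apply, Pi.smul_apply, smul_eq_mul] at *
  obtain rfl : b = 1 - a := by linarith
  rcases ha.eq_or_lt with rfl | ha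
  · simpa using hy
  nlinarith [mul_nonneg ha.le (mul_nonneg hb (sq_nonneg (x 0 - y 0))),
    mul_nonneg ha.le (mul_nonneg hb (sq_nonneg (x 1 - y 1))), mul_pos ha (sub_pos.2 hx),
    mul_nonneg hb (sub_pos.2 hy).le]

theorem zero_mem_unitDisk : (0 : Fin 2 → ℝ) ∈ unitDisk := by simp [unitDisk]

theorem norm_toComplex (x : Fin 2 → ℝ) : ‖toComplex x‖ = rad x := by
  rw [toComplex, Complex.norm_add_mul_I, rad, normSq_two]

theorem abs_harm_le (α : ℂ) (m : ℕ) (x : Fin 2 → ℝ) : |harm α m x| ≤ ‖α‖ * rad x ^ m := by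
  refine (Complex.abs_re_le_norm _).trans (le_of_eq ?_)
  rw [norm_mul, norm_pow, norm_toComplex]

theorem hasFDerivAt_rad {x : Fin 2 → ℝ} (hx : x ≠ 0) :
    HasFDerivAt rad (gradForm (x 0 / rad x) (x 1 / rad x)) x := by
  have hr := rad_pos hx
  have h0 : HasFDerivAt (fun x : Fin 2 → ℝ => x 0) (gradForm 1 0) x := by
    refine (hasFDerivAt_apply (𝕜 := ℝ) 0 x).congr_fderiv ?_
    ext v; simp
  have h1 : HasFDerivAt (fun x : Fin 2 → ℝ => x 1) (gradForm 0 1) x := by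
    refine (hasFDerivAt_apply (𝕜 := ℝ) 1 x).congr_fderiv ?_
    ext v; simp
  have h2 := (h0.pow 2).add (h1.pow 2)
  have h3 : (fun x : Fin 2 → ℝ => x 0 ^ 2 + x 1 ^ 2) x ≠ 0 := by
    simp only [← rad_sq]; positivity
  have h4 := h2.sqrt h3
  have e : rad = fun x : Fin 2 → ℝ => Real.sqrt (x 0 ^ 2 + x 1 ^ 2) := by
    funext y; rw [rad, normSq_two]
  have e' : Real.sqrt (x 0 ^ 2 + x 1 ^ 2) = rad x := by rw [e]
  rw [e]
  refine h4.congr_fderiv ?_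
  ext v
  simp [e']
  field_simp

theorem hasFDerivAt_harm (α : ℂ) (m : ℕ) (x : Fin 2 → ℝ) :
    HasFDerivAt (harm α m)
      (gradForm (m * harm α (m - 1) x) (m * harm (α * Complex.I) (m - 1) x)) x := by
  have h0 : HasFDerivAt (fun x : Fin 2 → ℝ => (x 0 : ℂ)) _ x :=
    Complex.ofRealCLM.hasFDerivAt.comp x (hasFDerivAt_apply (𝕜 := ℝ) 0 x)
  have h1 : HasFDerivAt (fun x : Fin 2 → ℝ => (x 1 : ℂ)) _ x :=
    Complex.ofRealCLM.hasFDerivAt.comp x (hasFDerivAt_apply (𝕜 := ℝ) 1 x)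
  have hz : HasFDerivAt toComplex _ x := h0.add (h1.mul_const Complex.I)
  have hp := (hasDerivAt_pow m (toComplex x)).comp_hasFDerivAt x hz
  have := Complex.reCLM.hasFDerivAt.comp x (hp.const_mul α)
  refine HasFDerivAt.congr_fderiv this ?_
  ext v
  have key : ∀ a b : ℝ, (α * ((m : ℂ) * toComplex x ^ (m - 1) * (a + Complex.I * b))).re
      = m * harm α (m - 1) x * a + m * harm (α * Complex.I) (m - 1) x * b := by
    intro a b
    have : α * ((m : ℂ) * toComplex x ^ (m - 1) * (a + Complex.I * b))
        = ((m * a : ℝ) : ℂ) * (α * toComplex x ^ (m - 1))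
          + ((m * b : ℝ) : ℂ) * (α * Complex.I * toComplex x ^ (m - 1)) := by
      push_cast; ring
    rw [this, Complex.add_re, Complex.re_ofReal_mul, Complex.re_ofReal_mul, harm, harm]
    ring
  have := key (v 0) (v 1)
  simp at this ⊢
  linarith

/-- Euler's identity for the homogeneous polynomial `harm α m`. -/
theorem harm_euler (α : ℂ) (m : ℕ) (x : Fin 2 → ℝ) :
    (m : ℝ) * (x 0 * harm α (m - 1) x + x 1 * harm (α * Complex.I) (m - 1) x)
      = m * harm α m x := by
  rcases m with _ | m
  · simp
  · simp only [add_tsub_cancel_right]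
    congr 1
    have : α * toComplex x ^ (m + 1) = (x 0 : ℂ) * (α * toComplex x ^ m)
        + (x 1 : ℂ) * (α * Complex.I * toComplex x ^ m) := by
      rw [pow_succ]; nth_rewrite 2 [toComplex]; ring
    rw [harm, harm, harm, this, Complex.add_re, Complex.re_ofReal_mul, Complex.re_ofReal_mul]

theorem harm_mul_I_mul_I (α : ℂ) (m : ℕ) (x : Fin 2 → ℝ) :
    harm (α * Complex.I * Complex.I) m x = -harm α m x := by
  have : α * Complex.I * Complex.I = -α := by rw [mul_assoc, Complex.I_mul_I]; ring
  simp [harm, this]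

theorem norm_mul_I_pow (α : ℂ) (j : ℕ) : ‖α * Complex.I ^ j‖ = ‖α‖ := by simp

/-- The function `f(r) r⁻ᵐ Re (α zᵐ)`. -/
def planar (m : ℕ) (f : ℝ → ℝ) (α : ℂ) (x : Fin 2 → ℝ) : ℝ :=
  f (rad x) / rad x ^ m * harm α m x

/-- The partial derivatives of `planar` away from the origin. -/
def planarGrad (m : ℕ) (f : ℝ → ℝ) (α : ℂ) (i : Fin 2) (x : Fin 2 → ℝ) : ℝ :=
  radialFlux m f (rad x) / rad x ^ (m + 1) * (x i * harm α m x) +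
    f (rad x) / rad x ^ m * (m * harm (α * Complex.I ^ (i : ℕ)) (m - 1) x)

namespace RadialODE

variable {m : ℕ} {c f : ℝ → ℝ}

theorem hasFDerivAt_planar (h : RadialODE m c f) (α : ℂ) {x : Fin 2 → ℝ} (hx : x ≠ 0)
    (hx1 : x ∈ unitDisk) :
    HasFDerivAt (planar m f α) (gradForm (planarGrad m f α 0 x) (planarGrad m f α 1 x)) x := by
  have hr := rad_pos hx
  have h1 := (h.hasDerivAt_div_pow ⟨hr, mem_unitDisk_iff.1 hx1⟩).comp_hasFDerivAt x
    (hasFDerivAt_rad hx)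
  refine (h1.mul (hasFDerivAt_harm α m x)).congr_fderiv ?_
  ext v
  simp [planarGrad]
  field_simp
  ring

theorem hasDerivAt_flux_div (h : RadialODE m c f) {r : ℝ} (hr : r ∈ Ioo (0:ℝ) 1) :
    HasDerivAt (fun r => radialFlux m f r / r ^ (m + 1))
      (-(2 * m + 2) * radialFlux m f r / r ^ (m + 2) - c r * f r / r ^ (m + 1)) r := by
  have hr0 : r ≠ 0 := hr.1.ne'
  refine ((h.hasDerivAt_radialFlux hr).div (hasDerivAt_pow (m + 1) r)
    (pow_ne_zero _ hr0)).congr_deriv ?_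
  push_cast
  field_simp
  ring

theorem hasFDerivAt_planarGrad (h : RadialODE m c f) (α : ℂ) {x : Fin 2 → ℝ} (hx : x ≠ 0)
    (hx1 : x ∈ unitDisk) :
    ∃ D : Fin 2 → ((Fin 2 → ℝ) →L[ℝ] ℝ),
      (∀ i, HasFDerivAt (planarGrad m f α i) (D i) x) ∧
      ∑ i, D i (Pi.single i 1) = -(c (rad x) * planar m f α x) := by
  have hr := rad_pos hx
  have hr1 : rad x ∈ Ioo (0:ℝ) 1 := ⟨hr, mem_unitDisk_iff.1 hx1⟩
  have hρ := (h.hasDerivAt_flux_div hr1).comp_hasFDerivAt x (hasFDerivAt_rad hx)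
  have hp := (h.hasDerivAt_div_pow hr1).comp_hasFDerivAt x (hasFDerivAt_rad hx)
  have hi : ∀ i, HasFDerivAt (planarGrad m f α i) _ x := fun i =>
    (hρ.mul ((hasFDerivAt_apply (𝕜 := ℝ) i x).mul (hasFDerivAt_harm α m x))).add
      (hp.mul ((hasFDerivAt_harm (α * Complex.I ^ (i : ℕ)) (m - 1) x).const_mul (m : ℝ)))
  refine ⟨_, hi, ?_⟩
  have euler := harm_euler α m x
  have hsq := rad_sq x
  rw [Fin.sum_univ_two]
  simp [harm_mul_I_mul_I, planar]
  field_simp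
  linear_combination (2 * radialFlux m f (rad x) * rad x ^ (2 * m + 3)) * euler +
    (2 * radialFlux m f (rad x) * (m + 1) * harm α m x * rad x ^ (2 * m + 1) +
      harm α m x * rad x ^ (2 * m + 2) * c (rad x) * f (rad x)) * hsq

theorem continuousAt_planarGrad (h : RadialODE m c f) (α : ℂ) (i : Fin 2) {x : Fin 2 → ℝ}
    (hx : x ≠ 0) (hx1 : x ∈ unitDisk) : ContinuousAt (planarGrad m f α i) x := by
  obtain ⟨D, hD, -⟩ := h.hasFDerivAt_planarGrad α hx hx1
  exact (hD i).continuousAt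

theorem abs_planar_le (f : ℝ → ℝ) (α : ℂ) {x : Fin 2 → ℝ} (hx : x ≠ 0) :
    |planar m f α x| ≤ |f (rad x)| * ‖α‖ := by
  have hr := pow_pos (rad_pos hx) m
  rw [planar, abs_mul, abs_div, abs_of_pos hr]
  calc |f (rad x)| / rad x ^ m * |harm α m x|
      ≤ |f (rad x)| / rad x ^ m * (‖α‖ * rad x ^ m) := by
        gcongr; exact abs_harm_le α m x
    _ = _ := by field_simp

theorem abs_flux_term_le (f : ℝ → ℝ) (α : ℂ) (i : Fin 2) {x : Fin 2 → ℝ} (hx : x ≠ 0) :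
    |radialFlux m f (rad x) / rad x ^ (m + 1) * (x i * harm α m x)|
      ≤ |radialFlux m f (rad x)| * ‖α‖ := by
  have hr := rad_pos hx
  rw [abs_mul, abs_div, abs_of_pos (pow_pos hr _), abs_mul]
  calc |radialFlux m f (rad x)| / rad x ^ (m + 1) * (|x i| * |harm α m x|)
      ≤ |radialFlux m f (rad x)| / rad x ^ (m + 1) * (rad x * (‖α‖ * rad x ^ m)) := by
        gcongr
        · exact abs_apply_le_rad x i
        · exact abs_harm_le α m x
    _ = _ := by field_simp; ring

theorem abs_harm_term_le (hm : m ≠ 0) (f : ℝ → ℝ) (α : ℂ) {x : Fin 2 → ℝ}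
    (hx : x ≠ 0) :
    |f (rad x) / rad x ^ m * (m * harm α (m - 1) x)| ≤ |f (rad x) / rad x| * (m * ‖α‖) := by
  obtain ⟨n, rfl⟩ := Nat.exists_eq_succ_of_ne_zero hm
  have hr := rad_pos hx
  simp only [Nat.succ_eq_add_one, add_tsub_cancel_right]
  rw [abs_mul, abs_div, abs_of_pos (pow_pos hr _), abs_mul, Nat.abs_cast, abs_div, abs_of_pos hr]
  calc |f (rad x)| / rad x ^ (n + 1) * (((n + 1 : ℕ) : ℝ) * |harm α n x|)
      ≤ |f (rad x)| / rad x ^ (n + 1) * (((n + 1 : ℕ) : ℝ) * (‖α‖ * rad x ^ n)) := by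
        gcongr
        exact abs_harm_le α n x
    _ = _ := by field_simp; ring

theorem exists_abs_planarGrad_le (h : RadialODE m c f) (α : ℂ) :
    ∃ K, ∀ x ∈ unitDisk, x ≠ 0 → ∀ i, |planarGrad m f α i x| ≤ K := by
  obtain ⟨N, hN0, hN⟩ := h.exists_abs_radialFlux_le
  have h2 : ∃ K', ∀ x ∈ unitDisk, x ≠ 0 → ∀ i : Fin 2,
      |f (rad x) / rad x ^ m * (m * harm (α * Complex.I ^ (i : ℕ)) (m - 1) x)| ≤ K' := by
    rcases eq_or_ne m 0 with rfl | hm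
    · exact ⟨0, fun x _ _ i => by simp⟩
    · obtain ⟨K, hK0, hK⟩ := h.exists_abs_div_le hm
      refine ⟨K * (m * ‖α‖), fun x hx hx0 i => (abs_harm_term_le hm f _ hx0).trans ?_⟩
      rw [norm_mul_I_pow]
      have := hK (rad x) ⟨rad_pos hx0, mem_unitDisk_iff.1 hx⟩
      gcongr
  obtain ⟨K', hK'⟩ := h2
  refine ⟨N * ‖α‖ + K', fun x hx hx0 i => ?_⟩
  have hr := rad_pos hx0
  have hr1 := mem_unitDisk_iff.1 hx
  refine (abs_add_le _ _).trans (add_le_add ((abs_flux_term_le f α i hx0).trans ?_) (hK' x hx hx0 i))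
  have := hN (rad x) ⟨hr, hr1⟩
  have h3 : N * rad x ≤ N := mul_le_of_le_one_right hN0 hr1.le
  gcongr
  linarith

theorem tendsto_rad_nhdsNE : Tendsto rad (𝓝[≠] 0) (𝓝[>] 0) := by
  refine tendsto_nhdsWithin_iff.2 ⟨?_, ?_⟩
  · have := continuous_rad.tendsto 0
    rw [rad_zero] at this
    exact this.mono_left nhdsWithin_le_nhds
  · filter_upwards [self_mem_nhdsWithin] with x hx using rad_pos hx

theorem exists_tendsto_planarGrad (h : RadialODE m c f) (α : ℂ) (i : Fin 2) :
    ∃ L, Tendsto (planarGrad m f α i) (𝓝[≠] 0) (𝓝 L) := by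
  obtain ⟨N, hN0, hN⟩ := h.exists_abs_radialFlux_le
  have hdisk : ∀ᶠ x : Fin 2 → ℝ in 𝓝[≠] 0, x ∈ unitDisk :=
    nhdsWithin_le_nhds (isOpen_unitDisk.mem_nhds zero_mem_unitDisk)
  have h1 : Tendsto (fun x : Fin 2 → ℝ =>
      radialFlux m f (rad x) / rad x ^ (m + 1) * (x i * harm α m x)) (𝓝[≠] 0) (𝓝 0) := by
    refine squeeze_zero_norm' (a := fun x => N * rad x * ‖α‖) ?_ ?_
    · filter_upwards [hdisk, self_mem_nhdsWithin] with x hx hx0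
      refine (abs_flux_term_le f α i hx0).trans ?_
      have := hN (rad x) ⟨rad_pos hx0, mem_unitDisk_iff.1 hx⟩
      gcongr
    · have : Tendsto (fun x => N * rad x * ‖α‖) (𝓝 0) (𝓝 (N * rad 0 * ‖α‖)) :=
        ((continuous_const.mul continuous_rad).mul continuous_const).tendsto 0
      simpa using this.mono_left nhdsWithin_le_nhds
  have h2 : ∃ L, Tendsto (fun x : Fin 2 → ℝ =>
      f (rad x) / rad x ^ m * (m * harm (α * Complex.I ^ (i : ℕ)) (m - 1) x)) (𝓝[≠] 0) (𝓝 L) := by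
    rcases eq_or_ne m 0 with rfl | hm
    · exact ⟨0, by simp⟩
    obtain ⟨a, ha, ha2⟩ := h.exists_tendsto_div hm
    have ha' := ha.comp tendsto_rad_nhdsNE
    rcases Nat.lt_or_ge m 2 with h2 | h2
    · obtain rfl : m = 1 := by omega
      refine ⟨a * (α * Complex.I ^ (i : ℕ)).re, ?_⟩
      simpa [harm, Function.comp_def] using ha'.mul_const ((α * Complex.I ^ (i : ℕ)).re)
    · rw [ha2 h2] at ha'
      refine ⟨0, squeeze_zero_norm' (a := fun x => |f (rad x) / rad x| * (m * ‖α‖)) ?_ ?_⟩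
      · filter_upwards [self_mem_nhdsWithin] with x hx0
        have := abs_harm_term_le hm f (α * Complex.I ^ (i : ℕ)) hx0
        rwa [norm_mul_I_pow] at this
      · simpa [Function.comp_def] using ha'.abs.mul_const (m * ‖α‖)
  obtain ⟨L, hL⟩ := h2
  exact ⟨0 + L, h1.add hL⟩

theorem continuousOn_planar (h : RadialODE m c f) (α : ℂ) :
    ContinuousOn (planar m f α) {x | rad x ≤ 1} := by
  have hf : ContinuousOn (fun x => f (rad x)) {x | rad x ≤ 1} :=
    h.continuousOn.comp continuous_rad.continuousOn fun x hx => ⟨rad_nonneg x, hx⟩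
  have hP : ∀ x, ContinuousAt (harm α m) x := fun x => (hasFDerivAt_harm α m x).continuousAt
  rcases eq_or_ne m 0 with rfl | hm
  · refine (hf.mul (fun x _ => (hP x).continuousWithinAt)).congr fun x _ => ?_
    simp [planar]
  intro x hx
  rcases eq_or_ne x 0 with rfl | hx0
  · have hz : planar m f α 0 = 0 := by simp [planar, h.zero hm]
    rw [ContinuousWithinAt, hz]
    refine squeeze_zero_norm (a := fun x => |f (rad x)| * ‖α‖) (fun y => ?_) ?_
    · rcases eq_or_ne y 0 with rfl | hy
      · rw [hz]; simp; positivity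
      · exact abs_planar_le f α hy
    · have := ((hf 0 hx).tendsto.abs).mul_const ‖α‖
      simpa [h.zero hm] using this
  · exact ((hf x hx).div (continuous_rad.continuousAt.continuousWithinAt.pow m)
      (pow_ne_zero _ (rad_pos hx0).ne')).mul (hP x).continuousWithinAt

end RadialODE

/-- A point is removable for differentiability when the partial derivatives extend to it. -/
theorem hasFDerivAt_zero_of_tendsto {h : (Fin 2 → ℝ) → ℝ} {G : Fin 2 → (Fin 2 → ℝ) → ℝ}
    {L : Fin 2 → ℝ} (hc : ContinuousOn h unitDisk)
    (hG : ∀ x ∈ unitDisk, x ≠ 0 → HasFDerivAt h (gradForm (G 0 x) (G 1 x)) x)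
    (hL : ∀ i, Tendsto (G i) (𝓝[≠] 0) (𝓝 (L i))) :
    HasFDerivAt h (gradForm (L 0) (L 1)) 0 := by
  refine HasFDerivAt.of_isLittleO ?_
  rw [Asymptotics.isLittleO_iff]
  intro η hη
  have hev : ∀ᶠ y : Fin 2 → ℝ in 𝓝[≠] 0, ∀ i, |G i y - L i| < η / 2 :=
    eventually_all.2 fun i => (Metric.tendsto_nhds.1 (hL i)) (η / 2) (by positivity)
  rw [eventually_nhdsWithin_iff, Metric.eventually_nhds_iff] at hev
  obtain ⟨δ, hδ, hev⟩ := hev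
  filter_upwards [Metric.ball_mem_nhds (0 : Fin 2 → ℝ) hδ,
    isOpen_unitDisk.mem_nhds zero_mem_unitDisk] with x hxδ hx
  rcases eq_or_ne x 0 with rfl | hx0
  · simp
  rw [mem_ball_zero_iff] at hxδ
  have hseg : ∀ t ∈ Icc (0:ℝ) 1, t • x ∈ unitDisk := fun t ht =>
    convex_unitDisk.starConvex zero_mem_unitDisk |>.smul_mem hx ht.1 ht.2
  have hline : ∀ t : ℝ, HasDerivAt (fun t : ℝ => t • x) x t := fun t => by
    simpa using (hasDerivAt_id t).smul_const x
  obtain ⟨t, ht, e⟩ := exists_hasDerivAt_eq_slope (fun t : ℝ => h (t • x))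
    (fun t => gradForm (G 0 (t • x)) (G 1 (t • x)) x) zero_lt_one
    (hc.comp (by fun_prop) hseg)
    (fun t ht => (hG _ (hseg t (Ioo_subset_Icc_self ht))
      (smul_ne_zero ht.1.ne' hx0)).comp_hasDerivAt t (hline t))
  simp only [one_smul, zero_smul, sub_zero, div_one] at e
  have htx : dist (t • x) 0 < δ := by
    rw [dist_zero_right, norm_smul, Real.norm_eq_abs, abs_of_pos ht.1]
    exact (mul_le_of_le_one_left (norm_nonneg _) ht.2.le).trans_lt hxδ
  have hb := hev htx (smul_ne_zero ht.1.ne' hx0)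
  rw [sub_zero, ← e, gradForm_apply, gradForm_apply, Real.norm_eq_abs]
  have e2 : G 0 (t • x) * x 0 + G 1 (t • x) * x 1 - (L 0 * x 0 + L 1 * x 1)
      = (G 0 (t • x) - L 0) * x 0 + (G 1 (t • x) - L 1) * x 1 := by ring
  rw [e2]
  refine (abs_add_le _ _).trans ?_
  rw [abs_mul, abs_mul]
  have n0 : |x 0| ≤ ‖x‖ := norm_le_pi_norm x 0
  have n1 : |x 1| ≤ ‖x‖ := norm_le_pi_norm x 1
  have b0 := mul_le_mul (hb 0).le n0 (abs_nonneg _) (by positivity)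
  have b1 := mul_le_mul (hb 1).le n1 (abs_nonneg _) (by positivity)
  linarith

theorem contDiffOn_one_of_hasFDerivAt {h : (Fin 2 → ℝ) → ℝ} {G : Fin 2 → (Fin 2 → ℝ) → ℝ}
    {s : Set (Fin 2 → ℝ)} (hs : IsOpen s)
    (hG : ∀ x ∈ s, HasFDerivAt h (gradForm (G 0 x) (G 1 x)) x)
    (hcont : ∀ i, ContinuousOn (G i) s) : ContDiffOn ℝ 1 h s := by
  rw [show (1 : WithTop ℕ∞) = 0 + 1 from rfl, contDiffOn_succ_iff_fderiv_of_isOpen hs]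
  refine ⟨fun x hx => (hG x hx).differentiableAt.differentiableWithinAt, by simp, ?_⟩
  rw [contDiffOn_zero]
  have : ContinuousOn (fun x => gradForm (G 0 x) (G 1 x)) s := by
    unfold gradForm
    exact ((hcont 0).smul continuousOn_const).add ((hcont 1).smul continuousOn_const)
  exact this.congr fun x hx => (hG x hx).fderiv

/-- The partial derivatives of `planar`, extended to the origin. -/
theorem RadialODE.exists_grad {m : ℕ} {c f : ℝ → ℝ} (h : RadialODE m c f) (α : ℂ) :
    ∃ G : Fin 2 → (Fin 2 → ℝ) → ℝ,
      (∀ x ∈ unitDisk, HasFDerivAt (planar m f α) (gradForm (G 0 x) (G 1 x)) x) ∧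
      (∀ i, ContinuousOn (G i) unitDisk) ∧
      (∀ x, x ≠ 0 → ∀ i, G i x = planarGrad m f α i x) := by
  choose L hL using h.exists_tendsto_planarGrad α
  refine ⟨fun i => Function.update (planarGrad m f α i) 0 (L i), ?_, ?_, ?_⟩
  · intro x hx
    rcases eq_or_ne x 0 with rfl | hx0
    · simp only [Function.update_self]
      exact hasFDerivAt_zero_of_tendsto
        ((h.continuousOn_planar α).mono fun x hx => (mem_unitDisk_iff.1 hx).le)
        (fun x hx hx0 => h.hasFDerivAt_planar α hx0 hx) hL
    · simp only [Function.update_of_ne hx0]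
      exact h.hasFDerivAt_planar α hx0 hx
  · intro i x hx
    refine ContinuousAt.continuousWithinAt ?_
    rcases eq_or_ne x 0 with rfl | hx0
    · exact continuousAt_update_same.2 (hL i)
    · exact (continuousAt_update_of_ne hx0).2 (h.continuousAt_planarGrad α i hx0 hx)
  · intro x hx i
    exact Function.update_of_ne hx _ _

/-- `h` is a `C¹` function on the disk with bounded gradient that solves `-Δh = c h`, tested
against compactly supported `C¹` functions. -/
structure WeakSol (c h : (Fin 2 → ℝ) → ℝ) : Prop where
  contDiffOn : ContDiffOn ℝ 1 h unitDisk
  continuousOn : ContinuousOn h (closure unitDisk)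
  continuousOn_coeff : ContinuousOn c (closure unitDisk)
  bounded : ∃ K, ∀ x ∈ unitDisk, ∀ i, |fderiv ℝ h x (Pi.single i (1:ℝ))| ≤ K
  weak : ∀ (φ : (Fin 2 → ℝ) → ℝ) (K : Set (Fin 2 → ℝ)), IsCompact K → K ⊆ unitDisk →
    ContDiffOn ℝ 1 φ unitDisk → (∀ x ∈ unitDisk, x ∉ K → φ x = 0) →
    ∫ x in unitDisk, (gradDotS h φ x - c x * h x * φ x) = 0

theorem continuousOn_partial {φ : (Fin 2 → ℝ) → ℝ} (hφ : ContDiffOn ℝ 1 φ unitDisk)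
    (w : Fin 2 → ℝ) : ContinuousOn (fun x => fderiv ℝ φ x w) unitDisk :=
  (hφ.continuousOn_fderiv_of_isOpen isOpen_unitDisk le_rfl).clm_apply continuousOn_const

theorem continuousOn_gradDotS {φ ψ : (Fin 2 → ℝ) → ℝ} (hφ : ContDiffOn ℝ 1 φ unitDisk)
    (hψ : ContDiffOn ℝ 1 ψ unitDisk) : ContinuousOn (gradDotS φ ψ) unitDisk :=
  continuousOn_finsetSum _ fun _ _ => (continuousOn_partial hφ _).mul (continuousOn_partial hψ _)

theorem fderiv_eq_zero_of_support {φ : (Fin 2 → ℝ) → ℝ} {K : Set (Fin 2 → ℝ)} (hK : IsCompact K)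
    (h0 : ∀ x ∈ unitDisk, x ∉ K → φ x = 0) {x : Fin 2 → ℝ} (hx : x ∈ unitDisk) (hxK : x ∉ K) :
    fderiv ℝ φ x = 0 := by
  have : φ =ᶠ[𝓝 x] fun _ => 0 := by
    filter_upwards [isOpen_unitDisk.mem_nhds hx, hK.isClosed.isOpen_compl.mem_nhds hxK] with y hy hyK
    exact h0 y hy hyK
  rw [this.fderiv_eq]
  simp

theorem integrableOn_of_support {ψ : (Fin 2 → ℝ) → ℝ} {K : Set (Fin 2 → ℝ)} (hK : IsCompact K)
    (hKΩ : K ⊆ unitDisk) (hψ : ContinuousOn ψ unitDisk)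
    (h0 : ∀ x ∈ unitDisk, x ∉ K → ψ x = 0) : IntegrableOn ψ unitDisk :=
  ((hψ.mono hKΩ).integrableOn_compact hK).of_forall_sdiff_eq_zero
    isOpen_unitDisk.measurableSet fun x hx => h0 x hx.1 hx.2

theorem RadialODE.weak {m : ℕ} {c f : ℝ → ℝ} (h : RadialODE m c f) (α : ℂ)
    {φ : (Fin 2 → ℝ) → ℝ} {K : Set (Fin 2 → ℝ)} (hK : IsCompact K) (hKΩ : K ⊆ unitDisk)
    (hφ : ContDiffOn ℝ 1 φ unitDisk) (h0 : ∀ x ∈ unitDisk, x ∉ K → φ x = 0) :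
    ∫ x in unitDisk,
      (gradDotS (planar m f α) φ x - c (rad x) * planar m f α x * φ x) = 0 := by
  obtain ⟨G, hG, hGc, hG0⟩ := h.exists_grad α
  set ψ : (Fin 2 → ℝ) → ℝ := fun x =>
    gradDotS (planar m f α) φ x - c (rad x) * planar m f α x * φ x with hψ
  set F : (Fin 2 → ℝ) → Fin 2 → ℝ := K.indicator fun x i => φ x * G i x with hF
  have hC1 : ContDiffOn ℝ 1 (planar m f α) unitDisk :=
    contDiffOn_one_of_hasFDerivAt isOpen_unitDisk hG hGc
  have hFin : ∀ x ∈ unitDisk, F =ᶠ[𝓝 x] fun x i => φ x * G i x := fun x hx => by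
    filter_upwards [isOpen_unitDisk.mem_nhds hx] with y hy
    by_cases hyK : y ∈ K
    · simp [hF, hyK]
    · ext i; simp [hF, hyK, h0 y hy hyK]
  have hFout : ∀ x ∉ K, F =ᶠ[𝓝 x] fun _ => 0 := fun x hx => by
    filter_upwards [hK.isClosed.isOpen_compl.mem_nhds hx] with y hy
    simp [hF, show y ∉ K from hy]
  have hφd : ∀ x ∈ unitDisk, HasFDerivAt φ (fderiv ℝ φ x) x := fun x hx =>
    ((hφ.differentiableOn (by norm_num)).differentiableAt
      (isOpen_unitDisk.mem_nhds hx)).hasFDerivAt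
  have hFcont : Continuous F := continuous_iff_continuousAt.2 fun x => by
    by_cases hx : x ∈ unitDisk
    · refine ContinuousAt.congr ?_ (hFin x hx).symm
      exact continuousAt_pi.2 fun i => (hφd x hx).continuousAt.mul
        ((hGc i).continuousAt (isOpen_unitDisk.mem_nhds hx))
    · exact continuousAt_const.congr (hFout x fun hxK => hx (hKΩ hxK)).symm
  have hFd : ∀ x, x ≠ 0 → DifferentiableAt ℝ F x ∧
      ∑ i, fderiv ℝ F x (Pi.single i 1) i = unitDisk.indicator ψ x := fun x hx0 => by
    by_cases hx : x ∈ unitDisk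
    · obtain ⟨D, hD, hdiv⟩ := h.hasFDerivAt_planarGrad α hx0 hx
      have hGd : ∀ i, HasFDerivAt (G i) (D i) x := fun i => by
        refine (hD i).congr_of_eventuallyEq ?_
        filter_upwards [isOpen_ne.mem_nhds hx0] with y hy using hG0 y hy i
      have hFx : HasFDerivAt F _ x := HasFDerivAt.congr_of_eventuallyEq
        (hasFDerivAt_pi.2 fun i => (hφd x hx).mul (hGd i)) (hFin x hx)
      refine ⟨hFx.differentiableAt, ?_⟩
      rw [hFx.fderiv, indicator_of_mem hx, hψ]
      simp only [gradDotS, (hG x hx).fderiv]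
      rw [Fin.sum_univ_two] at hdiv ⊢
      simp [Fin.sum_univ_two]
      linear_combination (φ x) * hdiv
    · have hxK : x ∉ K := fun hxK => hx (hKΩ hxK)
      refine ⟨(differentiableAt_const _).congr_of_eventuallyEq (hFout x hxK), ?_⟩
      rw [(hFout x hxK).fderiv_eq, indicator_of_notMem hx]
      simp
  have hae : (fun x => ∑ i, fderiv ℝ F x (Pi.single i 1) i) =ᵐ[volume] unitDisk.indicator ψ := by
    have : ∀ᵐ x : Fin 2 → ℝ, x ≠ 0 := by
      simp [ae_iff]
    filter_upwards [this] with x hx using (hFd x hx).2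
  have hcplan : ContinuousOn (fun x => c (rad x)) unitDisk :=
    h.continuousOn_coeff.comp continuous_rad.continuousOn
      fun x hx => ⟨rad_nonneg x, (mem_unitDisk_iff.1 hx).le⟩
  have hψc : ContinuousOn ψ unitDisk :=
    (continuousOn_gradDotS hC1 hφ).sub ((hcplan.mul hC1.continuousOn).mul hφ.continuousOn)
  have hψi : IntegrableOn ψ unitDisk := integrableOn_of_support hK hKΩ hψc fun x hx hxK => by
    simp [hψ, gradDotS, fderiv_eq_zero_of_support hK h0 hx hxK, h0 x hx hxK]
  have hind : Integrable (unitDisk.indicator ψ) :=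
    (integrable_indicator_iff isOpen_unitDisk.measurableSet).2 hψi
  have hdiv := integral_divergence_of_hasFDerivAt_off_countable (n := 1) (-1) 1
    (fun i => by simp only [Pi.neg_apply, Pi.one_apply]; norm_num) F (fderiv ℝ F) {0}
    (countable_singleton 0) hFcont.continuousOn
    (fun x hx => (hFd x hx.2).1.hasFDerivAt)
    ((hind.congr hae.symm).integrableOn)
  have hface : ∀ (i : Fin 2) (t : ℝ), |t| = 1 → ∀ y : Fin 1 → ℝ,
      F (i.insertNth t y) i = 0 := fun i t ht y => by
    have : (i.insertNth t y : Fin 2 → ℝ) ∉ K := fun hmem => by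
      have h1 := mem_unitDisk_iff.1 (hKΩ hmem)
      have h2 := abs_apply_le_rad (i.insertNth t y) i
      rw [Fin.insertNth_apply_same, ht] at h2
      linarith
    simp [hF, this]
  have hz : ∑ i : Fin (1 + 1),
      ((∫ x in Icc ((-1 : Fin (1 + 1) → ℝ) ∘ i.succAbove) ((1 : Fin (1 + 1) → ℝ) ∘ i.succAbove),
          F (i.insertNth ((1 : Fin (1 + 1) → ℝ) i) x) i)
        - ∫ x in Icc ((-1 : Fin (1 + 1) → ℝ) ∘ i.succAbove)
            ((1 : Fin (1 + 1) → ℝ) ∘ i.succAbove),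
          F (i.insertNth ((-1 : Fin (1 + 1) → ℝ) i) x) i) = 0 := by
    refine Finset.sum_eq_zero fun i _ => ?_
    rw [integral_eq_zero_of_ae, integral_eq_zero_of_ae, sub_zero]
    · exact ae_of_all _ fun y => hface i _ (by simp) y
    · exact ae_of_all _ fun y => hface i _ (by simp) y
  rw [hz, integral_congr_ae (ae_restrict_of_ae hae),
    setIntegral_indicator isOpen_unitDisk.measurableSet,
    inter_eq_self_of_subset_right unitDisk_subset_Icc] at hdiv
  exact hdiv

theorem RadialODE.weakSol {m : ℕ} {c f : ℝ → ℝ} (h : RadialODE m c f) (α : ℂ) :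
    WeakSol (fun x => c (rad x)) (planar m f α) := by
  obtain ⟨G, hG, hGc, hG0⟩ := h.exists_grad α
  refine ⟨contDiffOn_one_of_hasFDerivAt isOpen_unitDisk hG hGc,
    (h.continuousOn_planar α).mono fun x hx => rad_le_one_of_mem_closure hx,
    h.continuousOn_coeff.comp continuous_rad.continuousOn
      fun x hx => ⟨rad_nonneg x, rad_le_one_of_mem_closure hx⟩, ?_,
    fun φ K hK hKΩ hφ h0 => h.weak α hK hKΩ hφ h0⟩
  obtain ⟨K, hK⟩ := h.exists_abs_planarGrad_le α
  refine ⟨max K (max |G 0 0| |G 1 0|), fun x hx i => ?_⟩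
  have e : fderiv ℝ (planar m f α) x (Pi.single i 1) = G i x := by
    rw [(hG x hx).fderiv]; fin_cases i <;> simp
  rw [e]
  rcases eq_or_ne x 0 with rfl | hx0
  · fin_cases i
    · exact (le_max_left _ _).trans (le_max_right _ _)
    · exact (le_max_right _ _).trans (le_max_right _ _)
  · rw [hG0 x hx0 i]
    exact (hK x hx hx0 i).trans (le_max_left _ _)

/-- A `C¹` function vanishing on `[-1, 1]` and equal to the identity where `2 ≤ s²`. -/
def cutoff (s : ℝ) : ℝ := s * Real.smoothTransition (s ^ 2 - 1)

theorem contDiff_cutoff : ContDiff ℝ 1 cutoff :=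
  contDiff_id.mul ((Real.smoothTransition.contDiff (n := 1)).comp
    ((contDiff_id.pow 2).sub contDiff_const))

theorem cutoff_of_sq_le {s : ℝ} (hs : s ^ 2 ≤ 1) : cutoff s = 0 := by
  rw [cutoff, Real.smoothTransition.zero_of_nonpos (by linarith), mul_zero]

theorem cutoff_of_le_sq {s : ℝ} (hs : 2 ≤ s ^ 2) : cutoff s = s := by
  rw [cutoff, Real.smoothTransition.one_of_one_le (by linarith), mul_one]

theorem abs_cutoff_le (s : ℝ) : |cutoff s| ≤ |s| := by
  rw [cutoff, abs_mul, abs_of_nonneg (Real.smoothTransition.nonneg _)]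
  exact mul_le_of_le_one_right (abs_nonneg _) (Real.smoothTransition.le_one _)

theorem deriv_cutoff_of_lt {s : ℝ} (hs : 2 < s ^ 2) : deriv cutoff s = 1 := by
  have : cutoff =ᶠ[𝓝 s] id := by
    filter_upwards [(isOpen_lt continuous_const (continuous_pow 2)).mem_nhds hs] with t ht
    exact cutoff_of_le_sq (le_of_lt ht)
  rw [this.deriv_eq, deriv_id]

theorem exists_abs_deriv_cutoff_le : ∃ M, 0 ≤ M ∧ ∀ s, |deriv cutoff s| ≤ M := by
  obtain ⟨M, hM⟩ := (isCompact_Icc (a := (-2:ℝ)) (b := 2)).exists_bound_of_continuousOn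
    (contDiff_cutoff.continuous_deriv le_rfl).continuousOn
  refine ⟨max M 1, by positivity, fun s => ?_⟩
  by_cases hs : s ∈ Icc (-2:ℝ) 2
  · exact (hM s hs).trans (le_max_left _ _)
  · have : 2 < s ^ 2 := by
      by_contra! h
      exact hs ⟨by nlinarith, by nlinarith⟩
    rw [deriv_cutoff_of_lt this]
    simp

/-- Rescaled `cutoff`, vanishing on `[-1/(n+1), 1/(n+1)]`. -/
def trunc (n : ℕ) (s : ℝ) : ℝ := cutoff ((n + 1) * s) / (n + 1)

theorem contDiff_trunc (n : ℕ) : ContDiff ℝ 1 (trunc n) :=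
  (contDiff_cutoff.comp (contDiff_const.mul contDiff_id)).div_const _

theorem hasDerivAt_trunc (n : ℕ) (s : ℝ) :
    HasDerivAt (trunc n) (deriv cutoff ((n + 1) * s)) s := by
  have h1 : HasDerivAt (fun s : ℝ => ((n : ℝ) + 1) * s) ((n + 1) * 1) s :=
    (hasDerivAt_id s).const_mul _
  have h2 := ((contDiff_cutoff.differentiable (by norm_num) (((n : ℝ) + 1) * s)).hasDerivAt.comp s
    h1).div_const ((n : ℝ) + 1)
  refine h2.congr_deriv ?_
  have : (n : ℝ) + 1 ≠ 0 := by positivity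
  field_simp

theorem abs_trunc_le (n : ℕ) (s : ℝ) : |trunc n s| ≤ |s| := by
  have hn : (0:ℝ) < n + 1 := by positivity
  rw [trunc, abs_div, abs_of_pos hn, div_le_iff₀ hn]
  refine (abs_cutoff_le _).trans (le_of_eq ?_)
  rw [abs_mul, abs_of_pos hn, mul_comm]

theorem trunc_of_abs_le {n : ℕ} {s : ℝ} (hs : (n + 1) * |s| ≤ 1) : trunc n s = 0 := by
  rw [trunc, cutoff_of_sq_le, zero_div]
  rw [← sq_abs, abs_mul, abs_of_pos (by positivity : (0:ℝ) < n + 1)]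
  exact pow_le_one₀ (by positivity) hs

theorem eventually_trunc_eq {s : ℝ} (hs : s ≠ 0) :
    ∀ᶠ n : ℕ in atTop, trunc n s = s ∧ deriv cutoff ((n + 1) * s) = 1 := by
  obtain ⟨N, hN⟩ := exists_nat_gt (2 / |s|)
  have hs' := abs_pos.2 hs
  filter_upwards [eventually_ge_atTop N] with n hn
  have h1 : 2 < ((n : ℝ) + 1) * |s| := by
    rw [div_lt_iff₀ hs'] at hN
    have : (N : ℝ) ≤ n := by exact_mod_cast hn
    nlinarith
  have h2 : 2 < (((n : ℝ) + 1) * s) ^ 2 := by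
    rw [← sq_abs, abs_mul, abs_of_pos (by positivity : (0:ℝ) < n + 1)]
    nlinarith
  refine ⟨?_, deriv_cutoff_of_lt h2⟩
  rw [trunc, cutoff_of_le_sq h2.le]
  field_simp

/-- The gradient of a `C¹` function vanishes almost everywhere on its zero set. -/
theorem ae_fderiv_eq_zero {v : (Fin 2 → ℝ) → ℝ} (hv : ContDiffOn ℝ 1 v unitDisk) :
    ∀ᵐ x ∂volume.restrict unitDisk, v x = 0 → fderiv ℝ v x = 0 := by
  set s : Set (Fin 2 → ℝ) := unitDisk ∩ v ⁻¹' {0} with hs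
  have hsm : MeasurableSet s := by
    obtain ⟨t, ht, e⟩ := continuousOn_iff_isClosed.1 hv.continuousOn {0} isClosed_singleton
    rw [hs, inter_comm, e]
    exact ht.measurableSet.inter isOpen_unitDisk.measurableSet
  have happ : ApproximatesLinearOn (fun x => v x • (1 : Fin 2 → ℝ))
      (0 : (Fin 2 → ℝ) →L[ℝ] (Fin 2 → ℝ)) s 0 := by
    intro x hx y hy
    have hx0 : v x = 0 := hx.2
    have hy0 : v y = 0 := hy.2
    simp [hx0, hy0]
  have h := happ.norm_fderiv_sub_le volume hsm
    (fun x => (fderiv ℝ v x).smulRight (1 : Fin 2 → ℝ)) fun x hx =>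
      ((((hv.differentiableOn (by norm_num)).differentiableAt
        (isOpen_unitDisk.mem_nhds hx.1)).hasFDerivAt).smul_const _).hasFDerivWithinAt
  rw [ae_restrict_iff' hsm] at h
  rw [ae_restrict_iff' isOpen_unitDisk.measurableSet]
  filter_upwards [h] with x hx hxd hx0
  have h1 := hx ⟨hxd, hx0⟩
  simp only [sub_zero, nonpos_iff_eq_zero, nnnorm_eq_zero] at h1
  ext w
  have h2 := congrFun (DFunLike.congr_fun h1 w) 0
  simpa using h2

/-- Functions in `H¹₀` are approximated by compactly supported truncations. -/
theorem H10S.exists_approx {v : (Fin 2 → ℝ) → ℝ} (hv : H10S unitDisk v) :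
    ∃ (M : ℝ) (w : ℕ → (Fin 2 → ℝ) → ℝ) (K : ℕ → Set (Fin 2 → ℝ)), 0 ≤ M ∧
      (∀ n, IsCompact (K n) ∧ K n ⊆ unitDisk ∧ ContDiffOn ℝ 1 (w n) unitDisk ∧
        ∀ x ∈ unitDisk, x ∉ K n → w n x = 0) ∧
      (∀ n, ∀ x ∈ unitDisk, |w n x| ≤ |v x| ∧ ∀ i, |fderiv ℝ (w n) x (Pi.single i (1:ℝ))|
        ≤ M * |fderiv ℝ v x (Pi.single i (1:ℝ))|) ∧
      ∀ᵐ x ∂volume.restrict unitDisk, ∀ᶠ n in atTop,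
        w n x = v x ∧ fderiv ℝ (w n) x = fderiv ℝ v x := by
  obtain ⟨hC1, hcont, -, -, hbd⟩ := hv
  obtain ⟨M, hM0, hM⟩ := exists_abs_deriv_cutoff_le
  have hfd : ∀ n : ℕ, ∀ x ∈ unitDisk, fderiv ℝ (fun x => trunc n (v x)) x
      = deriv cutoff ((n + 1) * v x) • fderiv ℝ v x := fun n x hx =>
    ((hasDerivAt_trunc n (v x)).comp_hasFDerivAt x ((hC1.differentiableOn
      (by norm_num)).differentiableAt (isOpen_unitDisk.mem_nhds hx)).hasFDerivAt).fderiv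
  refine ⟨M, fun n x => trunc n (v x),
    fun n => closure unitDisk ∩ (fun x => |v x|) ⁻¹' Ici (1 / ((n : ℝ) + 1)),
    hM0, fun n => ⟨?_, ?_, ?_, ?_⟩, fun n x hx => ⟨abs_trunc_le n _, fun i => ?_⟩, ?_⟩
  · exact isCompact_closure_unitDisk.of_isClosed_subset
      (hcont.abs.preimage_isClosed_of_isClosed isClosed_closure isClosed_Ici) inter_subset_left
  · rintro x ⟨hx, hx1⟩
    by_contra hxd
    have : x ∈ frontier unitDisk := ⟨hx, by rwa [isOpen_unitDisk.interior_eq]⟩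
    have h0 : v x = 0 := hbd this
    have hn : (0:ℝ) < 1 / ((n : ℝ) + 1) := by positivity
    have hx2 : 1 / ((n : ℝ) + 1) ≤ |v x| := hx1
    rw [h0, abs_zero] at hx2
    linarith
  · exact (contDiff_trunc n).comp_contDiffOn hC1
  · intro x hx hxK
    refine trunc_of_abs_le ?_
    have : ¬ 1 / ((n : ℝ) + 1) ≤ |v x| := fun h => hxK ⟨subset_closure hx, h⟩
    rw [not_le, lt_div_iff₀ (by positivity)] at this
    linarith
  · rw [hfd n x hx, smul_apply, smul_eq_mul, abs_mul]
    exact mul_le_mul_of_nonneg_right (hM _) (abs_nonneg _)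
  · filter_upwards [ae_fderiv_eq_zero hC1, ae_restrict_mem isOpen_unitDisk.measurableSet]
      with x hx0 hx
    by_cases h : v x = 0
    · refine Eventually.of_forall fun n => ⟨?_, ?_⟩
      · simp only [h]; exact trunc_of_abs_le (by simp)
      · rw [hfd n x hx, hx0 h, smul_zero]
    · filter_upwards [eventually_trunc_eq h] with n hn
      exact ⟨hn.1, by rw [hfd n x hx, hn.2, one_smul]⟩

/-- The integrand of the quadratic form `∫ |∇φ|² - c φ²`. -/
def quadDensity (c φ : (Fin 2 → ℝ) → ℝ) (x : Fin 2 → ℝ) : ℝ := gradSqS φ x - c x * φ x ^ 2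

theorem gradSqS_nonneg (φ : (Fin 2 → ℝ) → ℝ) (x : Fin 2 → ℝ) : 0 ≤ gradSqS φ x :=
  by rw [gradSqS, gradDotS]; exact Finset.sum_nonneg fun i _ => mul_self_nonneg _

theorem gradSqS_le_of_abs_le {φ v : (Fin 2 → ℝ) → ℝ} {M : ℝ} {x : Fin 2 → ℝ}
    (h : ∀ i, |fderiv ℝ φ x (Pi.single i (1:ℝ))| ≤ M * |fderiv ℝ v x (Pi.single i (1:ℝ))|) :
    gradSqS φ x ≤ M ^ 2 * gradSqS v x := by
  simp only [gradSqS, gradDotS, Finset.mul_sum]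
  refine Finset.sum_le_sum fun i _ => ?_
  have h1 := mul_self_le_mul_self (abs_nonneg _) (h i)
  rw [abs_mul_abs_self] at h1
  refine h1.trans (le_of_eq ?_)
  rw [mul_mul_mul_comm, abs_mul_abs_self]
  ring

theorem exists_abs_le_of_continuousOn_closure {c : (Fin 2 → ℝ) → ℝ}
    (hc : ContinuousOn c (closure unitDisk)) : ∃ C, 0 ≤ C ∧ ∀ x ∈ unitDisk, |c x| ≤ C := by
  obtain ⟨C, hC⟩ := isCompact_closure_unitDisk.exists_bound_of_continuousOn hc
  exact ⟨C, (norm_nonneg _).trans (hC 0 (subset_closure zero_mem_unitDisk)),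
    fun x hx => hC x (subset_closure hx)⟩

theorem integrableOn_const_unitDisk (C : ℝ) : IntegrableOn (fun _ : Fin 2 → ℝ => C) unitDisk :=
  (continuousOn_const.integrableOn_compact isCompact_closure_unitDisk).mono_set subset_closure

theorem continuousOn_quadDensity {c φ : (Fin 2 → ℝ) → ℝ} (hc : ContinuousOn c (closure unitDisk))
    (hφ : ContDiffOn ℝ 1 φ unitDisk) : ContinuousOn (quadDensity c φ) unitDisk :=
  (continuousOn_gradDotS hφ hφ).sub ((hc.mono subset_closure).mul (hφ.continuousOn.pow 2))

theorem _root_.ContinuousOn.aestronglyMeasurable_unitDisk {ψ : (Fin 2 → ℝ) → ℝ}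
    (hψ : ContinuousOn ψ unitDisk) : AEStronglyMeasurable ψ (volume.restrict unitDisk) :=
  hψ.aestronglyMeasurable isOpen_unitDisk.measurableSet

/-- The quadratic form is continuous along truncations. -/
theorem tendsto_integral_quadDensity {c v : (Fin 2 → ℝ) → ℝ}
    (hc : ContinuousOn c (closure unitDisk)) (hv : H10S unitDisk v) {M : ℝ}
    {w : ℕ → (Fin 2 → ℝ) → ℝ} (hw : ∀ n, ContDiffOn ℝ 1 (w n) unitDisk)
    (hle : ∀ n, ∀ x ∈ unitDisk, |w n x| ≤ |v x| ∧ ∀ i, |fderiv ℝ (w n) x (Pi.single i (1:ℝ))|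
        ≤ M * |fderiv ℝ v x (Pi.single i (1:ℝ))|)
    (hlim : ∀ᵐ x ∂volume.restrict unitDisk, ∀ᶠ n in atTop,
        w n x = v x ∧ fderiv ℝ (w n) x = fderiv ℝ v x) :
    Tendsto (fun n => ∫ x in unitDisk, quadDensity c (w n) x) atTop
      (𝓝 (∫ x in unitDisk, quadDensity c v x)) := by
  obtain ⟨C, hC0, hC⟩ := exists_abs_le_of_continuousOn_closure hc
  refine tendsto_integral_of_dominated_convergence
    (fun x => M ^ 2 * gradSqS v x + C * v x ^ 2)
    (fun n => (continuousOn_quadDensity hc (hw n)).aestronglyMeasurable_unitDisk)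
    ((hv.2.2.1.const_mul _).add (hv.2.2.2.1.const_mul _)) (fun n => ?_) ?_
  · filter_upwards [ae_restrict_mem isOpen_unitDisk.measurableSet] with x hx
    obtain ⟨h1, h2⟩ := hle n x hx
    refine (abs_sub _ _).trans (add_le_add ?_ ?_)
    · rw [abs_of_nonneg (gradSqS_nonneg _ _)]
      exact gradSqS_le_of_abs_le h2
    · rw [abs_mul, abs_pow, ← sq_abs (v x)]
      exact mul_le_mul (hC x hx) (by gcongr) (by positivity) hC0
  · filter_upwards [hlim] with x hx
    refine tendsto_const_nhds.congr' ?_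
    filter_upwards [hx] with n hn
    simp only [quadDensity, gradSqS, gradDotS, hn.1, hn.2]

/-- A weak solution may be tested against all of `H¹₀`. -/
theorem WeakSol.integral_eq_zero {c h v : (Fin 2 → ℝ) → ℝ} (hh : WeakSol c h)
    (hv : H10S unitDisk v) :
    IntegrableOn (fun x => gradDotS h v x - c x * h x * v x) unitDisk ∧
      ∫ x in unitDisk, (gradDotS h v x - c x * h x * v x) = 0 := by
  obtain ⟨M, w, K, hM0, hw, hle, hlim⟩ := hv.exists_approx
  obtain ⟨B, hB⟩ := hh.bounded
  have hB0 : 0 ≤ B := (abs_nonneg _).trans (hB 0 zero_mem_unitDisk 0)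
  obtain ⟨C, hC0, hC⟩ := exists_abs_le_of_continuousOn_closure
    (hh.continuousOn_coeff.mul hh.continuousOn)
  have hcont : ∀ {φ : (Fin 2 → ℝ) → ℝ}, ContDiffOn ℝ 1 φ unitDisk →
      ContinuousOn (fun x => gradDotS h φ x - c x * h x * φ x) unitDisk := fun hφ =>
    (continuousOn_gradDotS hh.contDiffOn hφ).sub
      (((hh.continuousOn_coeff.mul hh.continuousOn).mono subset_closure).mul hφ.continuousOn)
  have hbi : IntegrableOn (fun x => B * (max M 1) * (2 + gradSqS v x) + C * (1 + v x ^ 2))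
      unitDisk :=
    (((integrableOn_const_unitDisk 2).add hv.2.2.1).const_mul _).add
      (((integrableOn_const_unitDisk 1).add hv.2.2.2.1).const_mul _)
  have hbound : ∀ (φ : (Fin 2 → ℝ) → ℝ) (N : ℝ), 0 ≤ N → N ≤ max M 1 → ∀ x ∈ unitDisk,
      |φ x| ≤ |v x| → (∀ i, |fderiv ℝ φ x (Pi.single i (1:ℝ))|
        ≤ N * |fderiv ℝ v x (Pi.single i (1:ℝ))|) →
      ‖gradDotS h φ x - c x * h x * φ x‖
        ≤ B * (max M 1) * (2 + gradSqS v x) + C * (1 + v x ^ 2) := by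
    intro φ N hN0 hN x hx h1 h2
    have key : ∀ t : ℝ, |t| ≤ 1 + t ^ 2 := fun t => by
      rw [← sq_abs]; nlinarith [sq_nonneg (|t| - 1), abs_nonneg t]
    refine (abs_sub _ _).trans (add_le_add ?_ ?_)
    · have : ∀ i : Fin 2, |fderiv ℝ h x (Pi.single i (1:ℝ)) * fderiv ℝ φ x (Pi.single i (1:ℝ))|
          ≤ B * (max M 1) * (1 + fderiv ℝ v x (Pi.single i (1:ℝ))
            * fderiv ℝ v x (Pi.single i (1:ℝ))) := fun i => by
        rw [abs_mul, mul_assoc]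
        refine mul_le_mul (hB x hx i) ((h2 i).trans ?_) (abs_nonneg _) hB0
        refine mul_le_mul hN ?_ (abs_nonneg _) (by positivity)
        have := key (fderiv ℝ v x (Pi.single i (1:ℝ)))
        rwa [sq] at this
      have h0 := this 0
      have h1 := this 1
      simp only [gradSqS, gradDotS, Fin.sum_univ_two]
      refine (abs_add_le _ _).trans ?_
      linarith
    · rw [abs_mul]
      exact mul_le_mul (hC x hx) (h1.trans (key _)) (abs_nonneg _) hC0
  have hint : IntegrableOn (fun x => gradDotS h v x - c x * h x * v x) unitDisk := by
    refine Integrable.mono' hbi (hcont hv.1).aestronglyMeasurable_unitDisk ?_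
    filter_upwards [ae_restrict_mem isOpen_unitDisk.measurableSet] with x hx
    exact hbound v 1 zero_le_one (le_max_right _ _) x hx le_rfl fun i => by rw [one_mul]
  refine ⟨hint, ?_⟩
  have hT : Tendsto (fun n => ∫ x in unitDisk, (gradDotS h (w n) x - c x * h x * w n x)) atTop
      (𝓝 (∫ x in unitDisk, (gradDotS h v x - c x * h x * v x))) := by
    refine tendsto_integral_of_dominated_convergence _
      (fun n => (hcont (hw n).2.2.1).aestronglyMeasurable_unitDisk) hbi (fun n => ?_) ?_
    · filter_upwards [ae_restrict_mem isOpen_unitDisk.measurableSet] with x hx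
      exact hbound (w n) M hM0 (le_max_left _ _) x hx (hle n x hx).1 (hle n x hx).2
    · filter_upwards [hlim] with x hx
      refine tendsto_const_nhds.congr' ?_
      filter_upwards [hx] with n hn
      simp only [gradDotS, hn.1, hn.2]
  refine tendsto_nhds_unique hT ?_
  simp only [fun n => hh.weak (w n) (K n) (hw n).1 (hw n).2.1 (hw n).2.2.1 (hw n).2.2.2]
  exact tendsto_const_nhds

theorem clm_apply_fin_two (L : (Fin 2 → ℝ) →L[ℝ] ℝ) (w : Fin 2 → ℝ) :
    L w = w 0 * L (Pi.single 0 1) + w 1 * L (Pi.single 1 1) := by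
  have h : w = w 0 • Pi.single 0 (1:ℝ) + w 1 • Pi.single 1 (1:ℝ) := by
    ext i; fin_cases i <;> simp
  conv_lhs => rw [h]
  simp

theorem hasFDerivAt_div {φ g : (Fin 2 → ℝ) → ℝ} {φ' g' : (Fin 2 → ℝ) →L[ℝ] ℝ} {x : Fin 2 → ℝ}
    (hφ : HasFDerivAt φ φ' x) (hg : HasFDerivAt g g' x) (hx : g x ≠ 0) :
    HasFDerivAt (φ / g) ((g x)⁻¹ • φ' - (φ x / g x ^ 2) • g') x := by
  rw [div_eq_mul_inv]
  refine (hφ.mul ((hasDerivAt_inv hx).comp_hasFDerivAt x hg)).congr_fderiv ?_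
  ext w
  simp
  field_simp
  ring

/-- The remainder in Picone's identity. -/
def picone (g φ : (Fin 2 → ℝ) → ℝ) (x : Fin 2 → ℝ) : ℝ :=
  ∑ i, (fderiv ℝ φ x (Pi.single i (1:ℝ)) - φ x / g x * fderiv ℝ g x (Pi.single i (1:ℝ))) ^ 2

theorem picone_nonneg (g φ : (Fin 2 → ℝ) → ℝ) (x : Fin 2 → ℝ) : 0 ≤ picone g φ x :=
  Finset.sum_nonneg fun _ _ => sq_nonneg _

namespace WeakSol

variable {c g : (Fin 2 → ℝ) → ℝ}

theorem continuousOn_picone (hg : WeakSol c g) (hpos : ∀ x ∈ unitDisk, 0 < g x)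
    {φ : (Fin 2 → ℝ) → ℝ} (hφ : ContDiffOn ℝ 1 φ unitDisk) :
    ContinuousOn (picone g φ) unitDisk :=
  continuousOn_finsetSum _ fun _ _ => ((continuousOn_partial hφ _).sub
    ((hφ.continuousOn.div hg.contDiffOn.continuousOn fun x hx => (hpos x hx).ne').mul
      (continuousOn_partial hg.contDiffOn _))).pow 2

theorem hasFDerivAt (hg : WeakSol c g) {x : Fin 2 → ℝ} (hx : x ∈ unitDisk) :
    HasFDerivAt g (fderiv ℝ g x) x :=
  ((hg.contDiffOn.differentiableOn (by norm_num)).differentiableAt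
    (isOpen_unitDisk.mem_nhds hx)).hasFDerivAt

theorem integral_quadDensity_eq (hg : WeakSol c g) (hpos : ∀ x ∈ unitDisk, 0 < g x)
    {φ : (Fin 2 → ℝ) → ℝ} {K : Set (Fin 2 → ℝ)} (hK : IsCompact K) (hKΩ : K ⊆ unitDisk)
    (hφ : ContDiffOn ℝ 1 φ unitDisk) (h0 : ∀ x ∈ unitDisk, x ∉ K → φ x = 0) :
    IntegrableOn (picone g φ) unitDisk ∧
      ∫ x in unitDisk, quadDensity c φ x = ∫ x in unitDisk, picone g φ x := by
  have hgne : ∀ x ∈ unitDisk, g x ≠ 0 := fun x hx => (hpos x hx).ne'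
  have hPi : IntegrableOn (picone g φ) unitDisk :=
    integrableOn_of_support hK hKΩ (hg.continuousOn_picone hpos hφ) fun x hx hxK => by
      simp [picone, fderiv_eq_zero_of_support hK h0 hx hxK, h0 x hx hxK]
  have hQi : IntegrableOn (quadDensity c φ) unitDisk :=
    integrableOn_of_support hK hKΩ (continuousOn_quadDensity hg.continuousOn_coeff hφ)
      fun x hx hxK => by
        simp [quadDensity, gradSqS, gradDotS, fderiv_eq_zero_of_support hK h0 hx hxK, h0 x hx hxK]
  refine ⟨hPi, ?_⟩
  have hψ := hg.weak (φ ^ 2 / g) K hK hKΩ ((hφ.pow 2).div hg.contDiffOn hgne)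
    fun x hx hxK => by simp [h0 x hx hxK]
  rw [← sub_eq_zero, ← integral_sub hQi hPi, ← hψ]
  refine setIntegral_congr_fun isOpen_unitDisk.measurableSet fun x hx => ?_
  have hφx : HasFDerivAt φ (fderiv ℝ φ x) x := ((hφ.differentiableOn
    (by norm_num)).differentiableAt (isOpen_unitDisk.mem_nhds hx)).hasFDerivAt
  have hd : HasFDerivAt (φ ^ 2 / g) _ x :=
    hasFDerivAt_div (hφx.pow 2) (hg.hasFDerivAt hx) (hgne x hx)
  have hgx := hgne x hx
  simp only [quadDensity, gradSqS, gradDotS, picone, hd.fderiv, Fin.sum_univ_two]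
  simp
  field_simp
  ring

theorem integral_quadDensity_nonneg (hg : WeakSol c g) (hpos : ∀ x ∈ unitDisk, 0 < g x)
    {v : (Fin 2 → ℝ) → ℝ} (hv : H10S unitDisk v) :
    0 ≤ ∫ x in unitDisk, quadDensity c v x := by
  obtain ⟨M, w, K, -, hw, hle, hlim⟩ := hv.exists_approx
  refine ge_of_tendsto' (tendsto_integral_quadDensity hg.continuousOn_coeff hv
    (fun n => (hw n).2.2.1) hle hlim) fun n => ?_
  rw [(hg.integral_quadDensity_eq hpos (hw n).1 (hw n).2.1 (hw n).2.2.1 (hw n).2.2.2).2]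
  exact integral_nonneg fun x => picone_nonneg _ _ _

theorem eq_const_mul_of_integral_eq_zero (hg : WeakSol c g) (hpos : ∀ x ∈ unitDisk, 0 < g x)
    {v : (Fin 2 → ℝ) → ℝ} (hv : H10S unitDisk v)
    (hQ : ∫ x in unitDisk, quadDensity c v x = 0) : ∃ a, ∀ x ∈ unitDisk, v x = a * g x := by
  obtain ⟨M, w, K, -, hw, hle, hlim⟩ := hv.exists_approx
  have hT := tendsto_integral_quadDensity hg.continuousOn_coeff hv
    (fun n => (hw n).2.2.1) hle hlim
  rw [hQ] at hT
  have hP := fun n =>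
    hg.integral_quadDensity_eq hpos (hw n).1 (hw n).2.1 (hw n).2.2.1 (hw n).2.2.2
  have hcont : ∀ {φ : (Fin 2 → ℝ) → ℝ}, ContDiffOn ℝ 1 φ unitDisk →
      AEMeasurable (fun x => ENNReal.ofReal (picone g φ x)) (volume.restrict unitDisk) := fun hφ =>
    (hg.continuousOn_picone hpos hφ).aestronglyMeasurable_unitDisk.aemeasurable.ennreal_ofReal
  have hL : Tendsto (fun n => ∫⁻ x in unitDisk, ENNReal.ofReal (picone g (w n) x)) atTop
      (𝓝 0) := by
    have := (ENNReal.continuous_ofReal.tendsto 0).comp hT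
    rw [ENNReal.ofReal_zero] at this
    refine this.congr fun n => ?_
    rw [Function.comp_apply, (hP n).2]
    exact ofReal_integral_eq_lintegral_ofReal (hP n).1
      (ae_of_all _ fun x => picone_nonneg _ _ _)
  have hzero : ∫⁻ x in unitDisk, ENNReal.ofReal (picone g v x) = 0 := by
    refine le_antisymm ?_ bot_le
    calc ∫⁻ x in unitDisk, ENNReal.ofReal (picone g v x)
        = ∫⁻ x in unitDisk, liminf (fun n => ENNReal.ofReal (picone g (w n) x)) atTop := by
          refine lintegral_congr_ae ?_
          filter_upwards [hlim] with x hx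
          refine (Tendsto.liminf_eq (tendsto_const_nhds.congr' ?_)).symm
          filter_upwards [hx] with n hn
          simp only [picone, hn.1, hn.2]
      _ ≤ liminf (fun n => ∫⁻ x in unitDisk, ENNReal.ofReal (picone g (w n) x)) atTop :=
          lintegral_liminf_le' fun n => hcont (hw n).2.2.1
      _ = 0 := hL.liminf_eq
  rw [lintegral_eq_zero_iff' (hcont hv.1)] at hzero
  have hae : picone g v =ᵐ[volume.restrict unitDisk] fun _ => 0 := by
    filter_upwards [hzero] with x hx
    exact le_antisymm (ENNReal.ofReal_eq_zero.1 hx) (picone_nonneg _ _ _)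
  have hpt := Measure.eqOn_open_of_ae_eq hae isOpen_unitDisk
    (hg.continuousOn_picone hpos hv.1) continuousOn_const
  have hvd : ∀ x ∈ unitDisk, HasFDerivAt v (fderiv ℝ v x) x := fun x hx =>
    ((hv.1.differentiableOn (by norm_num)).differentiableAt
      (isOpen_unitDisk.mem_nhds hx)).hasFDerivAt
  have hd : ∀ x (hx : x ∈ unitDisk), HasFDerivAt (v / g) _ x := fun x hx =>
    hasFDerivAt_div (hvd x hx) (hg.hasFDerivAt hx) (hpos x hx).ne'
  obtain ⟨a, ha⟩ := isOpen_unitDisk.exists_is_const_of_fderiv_eq_zero (𝕜 := ℝ) (f := v / g)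
    convex_unitDisk.isPreconnected
    (fun x hx => (hd x hx).differentiableAt.differentiableWithinAt) fun x hx => by
      have hgx := (hpos x hx).ne'
      have h2 := hpt hx
      simp only [picone, Fin.sum_univ_two] at h2
      have e0 : fderiv ℝ v x (Pi.single 0 1) - v x / g x * fderiv ℝ g x (Pi.single 0 1) = 0 := by
        nlinarith [sq_nonneg (fderiv ℝ v x (Pi.single 1 1) -
          v x / g x * fderiv ℝ g x (Pi.single 1 1))]
      have e1 : fderiv ℝ v x (Pi.single 1 1) - v x / g x * fderiv ℝ g x (Pi.single 1 1) = 0 := by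
        nlinarith [sq_nonneg (fderiv ℝ v x (Pi.single 0 1) -
          v x / g x * fderiv ℝ g x (Pi.single 0 1))]
      rw [(hd x hx).fderiv]
      ext w
      simp [clm_apply_fin_two _ w]
      linear_combination (w 0 / g x) * e0 + (w 1 / g x) * e1
  refine ⟨a, fun x hx => ?_⟩
  rw [← ha x hx, Pi.div_apply, div_mul_cancel₀ _ (hpos x hx).ne']

end WeakSol

theorem strictConvexOn_tangent_lt {W : ℝ → ℝ} (hW : ContDiffOn ℝ 1 W (Iic (1:ℝ)))
    (hWconv : StrictConvexOn ℝ (Iic (1:ℝ)) W) {s t : ℝ} (hs : s ≤ 1) (ht : t ≤ 1) (hst : s ≠ t) :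
    W s + Wd W s * (t - s) < W t := by
  have hd : ∀ r ≤ (1:ℝ), DifferentiableWithinAt ℝ W (Iic 1) r := fun r hr =>
    hW.differentiableOn (by norm_num) r hr
  rcases lt_or_gt_of_ne hst with h | h
  · have := hWconv.derivWithin_lt_slope hs ht h (hd s hs)
    rw [slope_def_field, lt_div_iff₀ (sub_pos.2 h)] at this
    rw [Wd]
    linarith
  · have := hWconv.slope_lt_derivWithin ht hs h (hd s hs)
    rw [slope_def_field, div_lt_iff₀ (sub_pos.2 h)] at this
    rw [Wd]
    linarith

theorem continuousOn_Wd {W : ℝ → ℝ} (hW : ContDiffOn ℝ 1 W (Iic (1:ℝ))) :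
    ContinuousOn (Wd W) (Iic (1:ℝ)) :=
  hW.continuousOn_derivWithin (uniqueDiffOn_Iic 1) le_rfl

theorem fderiv_component {u : (Fin 2 → ℝ) → Fin 3 → ℝ} {x : Fin 2 → ℝ}
    (hu : DifferentiableAt ℝ u x) (j : Fin 3) (w : Fin 2 → ℝ) :
    fderiv ℝ (fun y => u y j) x w = fderiv ℝ u x w j := by
  have := ((hasFDerivAt_pi'.1 hu.hasFDerivAt) j).fderiv
  rw [this]
  rfl

theorem gradSq_eq_sum {u : (Fin 2 → ℝ) → Fin 3 → ℝ} (hu : ContDiffOn ℝ 1 u unitDisk)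
    {x : Fin 2 → ℝ} (hx : x ∈ unitDisk) : gradSq u x = ∑ j, gradSqS (fun y => u y j) x := by
  have hd : DifferentiableAt ℝ u x :=
    (hu.differentiableOn (by norm_num)).differentiableAt (isOpen_unitDisk.mem_nhds hx)
  simp only [gradSq, gradDot, gradSqS, gradDotS, fderiv_component hd]
  exact Finset.sum_comm

theorem integrableOn_of_continuousOn_closure {φ : (Fin 2 → ℝ) → ℝ}
    (hφ : ContinuousOn φ (closure unitDisk)) : IntegrableOn φ unitDisk :=
  (hφ.integrableOn_compact isCompact_closure_unitDisk).mono_set subset_closure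

theorem H10S.integrableOn_quadDensity {c v : (Fin 2 → ℝ) → ℝ} (hv : H10S unitDisk v)
    (hc : ContinuousOn c (closure unitDisk)) : IntegrableOn (quadDensity c v) unitDisk :=
  hv.2.2.1.sub (integrableOn_of_continuousOn_closure (hc.mul (hv.2.1.pow 2)))

theorem WeakSol.integrableOn_gradSqS {c h : (Fin 2 → ℝ) → ℝ} (hh : WeakSol c h) :
    IntegrableOn (gradSqS h) unitDisk := by
  obtain ⟨B, hB⟩ := hh.bounded
  refine Integrable.mono' (integrableOn_const_unitDisk (2 * (B * B)))
    (continuousOn_gradDotS hh.contDiffOn hh.contDiffOn).aestronglyMeasurable_unitDisk ?_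
  filter_upwards [ae_restrict_mem isOpen_unitDisk.measurableSet] with x hx
  rw [Real.norm_of_nonneg (gradSqS_nonneg _ _), gradSqS, gradDotS, Fin.sum_univ_two]
  have h : ∀ i, fderiv ℝ h x (Pi.single i 1) * fderiv ℝ h x (Pi.single i 1) ≤ B * B := fun i => by
    rw [← abs_mul_abs_self]
    exact mul_self_le_mul_self (abs_nonneg _) (hB x hx i)
  linarith [h 0, h 1]

/-- A map of the disk whose components solve the Euler–Lagrange system, with coefficient `c`. -/
structure CriticalMap (W : ℝ → ℝ) (ε : ℝ) (c : (Fin 2 → ℝ) → ℝ)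
    (u : (Fin 2 → ℝ) → Fin 3 → ℝ) : Prop where
  weakSol : ∀ j, WeakSol c fun x => u x j
  coeff_eq : ∀ x ∈ unitDisk, c x = 1 / ε ^ 2 * Wd W (1 - normSq (u x))

namespace CriticalMap

variable {W : ℝ → ℝ} {ε : ℝ} {c : (Fin 2 → ℝ) → ℝ} {u v ubd : (Fin 2 → ℝ) → Fin 3 → ℝ}

theorem admissible (hu : CriticalMap W ε c u) (hbd : EqOn u ubd (frontier unitDisk)) :
    Admissible unitDisk ubd u := by
  have hC1 : ContDiffOn ℝ 1 u unitDisk := contDiffOn_pi.2 fun j => (hu.weakSol j).contDiffOn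
  have hc : ContinuousOn u (closure unitDisk) :=
    continuousOn_pi.2 fun j => (hu.weakSol j).continuousOn
  refine ⟨hC1, hc, ?_, integrableOn_of_continuousOn_closure
    (continuous_normSq.comp_continuousOn hc), hbd⟩
  refine IntegrableOn.congr_fun (f := fun x => ∑ j, gradSqS (fun y => u y j) x)
    (integrable_finsetSum _ fun j _ => (hu.weakSol j).integrableOn_gradSqS)
    (fun x hx => (gradSq_eq_sum hC1 hx).symm) isOpen_unitDisk.measurableSet

theorem h10S_sub (hu : CriticalMap W ε c u) (hbd : EqOn u ubd (frontier unitDisk))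
    (hv : Admissible unitDisk ubd v) (j : Fin 3) :
    H10S unitDisk fun x => v x j - u x j := by
  have hC1 : ContDiffOn ℝ 1 (fun x => v x j - u x j) unitDisk :=
    (contDiffOn_pi.1 hv.1 j).sub (hu.weakSol j).contDiffOn
  have hc : ContinuousOn (fun x => v x j - u x j) (closure unitDisk) :=
    (continuousOn_pi.1 hv.2.1 j).sub (hu.weakSol j).continuousOn
  refine ⟨hC1, hc, ?_, integrableOn_of_continuousOn_closure (hc.pow 2), fun x hx => ?_⟩
  · refine Integrable.mono' ((hv.2.2.1.const_mul 2).add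
      ((hu.weakSol j).integrableOn_gradSqS.const_mul 2))
      (continuousOn_gradDotS hC1 hC1).aestronglyMeasurable_unitDisk ?_
    filter_upwards [ae_restrict_mem isOpen_unitDisk.measurableSet] with x hx
    have hvd := (contDiffOn_pi.1 hv.1 j).differentiableOn (by norm_num) |>.differentiableAt
      (isOpen_unitDisk.mem_nhds hx)
    have hd := hvd.hasFDerivAt.sub ((hu.weakSol j).hasFDerivAt hx)
    have h1 : gradSqS (fun y => v y j) x ≤ gradSq v x := by
      rw [gradSq_eq_sum hv.1 hx]
      exact Finset.single_le_sum (f := fun j => gradSqS (fun y => v y j) x)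
        (fun i _ => gradSqS_nonneg _ _) (Finset.mem_univ j)
    rw [Real.norm_of_nonneg (gradSqS_nonneg _ _)]
    have hd' : fderiv ℝ (fun x => v x j - u x j) x
        = fderiv ℝ (fun y => v y j) x - fderiv ℝ (fun y => u y j) x := hd.fderiv
    have h2 : gradSqS (fun x => v x j - u x j) x
        ≤ 2 * gradSqS (fun y => v y j) x + 2 * gradSqS (fun y => u y j) x := by
      simp only [gradSqS, gradDotS, hd', Fin.sum_univ_two, sub_apply]
      nlinarith [sq_nonneg (fderiv ℝ (fun y => v y j) x (Pi.single 0 1)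
          + fderiv ℝ (fun y => u y j) x (Pi.single 0 1)),
        sq_nonneg (fderiv ℝ (fun y => v y j) x (Pi.single 1 1)
          + fderiv ℝ (fun y => u y j) x (Pi.single 1 1))]
    simp only [Pi.add_apply]
    linarith
  · have h1 := hbd hx
    have h2 := hv.2.2.2.2 hx
    simp [h1, h2]

/-- The convexity defect of the potential between `u` and `v`. -/
def defect (W : ℝ → ℝ) (ε : ℝ) (c : (Fin 2 → ℝ) → ℝ) (u v : (Fin 2 → ℝ) → Fin 3 → ℝ)
    (x : Fin 2 → ℝ) : ℝ :=
  W (1 - normSq (v x)) - W (1 - normSq (u x)) + ε ^ 2 * c x * (normSq (v x) - normSq (u x))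

theorem defect_pos (hW : ContDiffOn ℝ 1 W (Iic (1:ℝ))) (hWconv : StrictConvexOn ℝ (Iic (1:ℝ)) W)
    (hε : 0 < ε) (hu : CriticalMap W ε c u) {x : Fin 2 → ℝ} (hx : x ∈ unitDisk)
    (hne : normSq (v x) ≠ normSq (u x)) : 0 < defect W ε c u v x := by
  have h := strictConvexOn_tangent_lt hW hWconv (s := 1 - normSq (u x)) (t := 1 - normSq (v x))
    (by linarith [normSq_nonneg (u x)]) (by linarith [normSq_nonneg (v x)])
    (fun e => hne (by linarith))
  rw [defect, hu.coeff_eq x hx]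
  have e : ε ^ 2 * (1 / ε ^ 2 * Wd W (1 - normSq (u x))) = Wd W (1 - normSq (u x)) := by
    field_simp
  rw [e]
  linarith

theorem defect_nonneg (hW : ContDiffOn ℝ 1 W (Iic (1:ℝ)))
    (hWconv : StrictConvexOn ℝ (Iic (1:ℝ)) W)
    (hε : 0 < ε) (hu : CriticalMap W ε c u) (v : (Fin 2 → ℝ) → Fin 3 → ℝ) {x : Fin 2 → ℝ}
    (hx : x ∈ unitDisk) : 0 ≤ defect W ε c u v x := by
  by_cases h : normSq (v x) = normSq (u x)
  · simp [defect, h]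
  · exact (defect_pos hW hWconv hε hu hx h).le

theorem continuousOn_potential (hW : ContDiffOn ℝ 1 W (Iic (1:ℝ)))
    (hv : ContinuousOn v (closure unitDisk)) :
    ContinuousOn (fun x => W (1 - normSq (v x))) (closure unitDisk) :=
  hW.continuousOn.comp (continuousOn_const.sub (continuous_normSq.comp_continuousOn hv))
    fun x _ => by simpa using normSq_nonneg (v x)

theorem continuousOn_defect (hW : ContDiffOn ℝ 1 W (Iic (1:ℝ))) (hu : CriticalMap W ε c u)
    (hv : ContinuousOn v (closure unitDisk)) :
    ContinuousOn (defect W ε c u v) (closure unitDisk) := by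
  have hc : ContinuousOn u (closure unitDisk) :=
    continuousOn_pi.2 fun j => (hu.weakSol j).continuousOn
  exact ((continuousOn_potential hW hv).sub (continuousOn_potential hW hc)).add
    ((continuousOn_const.mul (hu.weakSol 0).continuousOn_coeff).mul
      ((continuous_normSq.comp_continuousOn hv).sub (continuous_normSq.comp_continuousOn hc)))

theorem integrableOn_density (hW : ContDiffOn ℝ 1 W (Iic (1:ℝ)))
    (hv : Admissible unitDisk ubd v) :
    IntegrableOn (fun x => gradSq v x / 2 + W (1 - normSq (v x)) / (2 * ε ^ 2)) unitDisk :=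
  (hv.2.2.1.div_const 2).add
    ((integrableOn_of_continuousOn_closure (continuousOn_potential hW hv.2.1)).div_const _)

theorem energy_sub (hW : ContDiffOn ℝ 1 W (Iic (1:ℝ))) (hε : 0 < ε) (hu : CriticalMap W ε c u)
    (hbd : EqOn u ubd (frontier unitDisk)) (hv : Admissible unitDisk ubd v) :
    GLenergy W ε unitDisk v - GLenergy W ε unitDisk u
      = (∑ j, ∫ x in unitDisk, quadDensity c (fun y => v y j - u y j) x) / 2
        + (∫ x in unitDisk, defect W ε c u v x) / (2 * ε ^ 2) := by
  have hua := hu.admissible hbd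
  have hw := hu.h10S_sub hbd hv
  have hwk := fun j => (hu.weakSol j).integral_eq_zero (hw j)
  have hq := fun j => (hw j).integrableOn_quadDensity (hu.weakSol j).continuousOn_coeff
  have hD := integrableOn_of_continuousOn_closure (hu.continuousOn_defect hW hv.2.1)
  rw [GLenergy, GLenergy, ← integral_sub (integrableOn_density hW hv) (integrableOn_density hW hua)]
  have key : ∀ x ∈ unitDisk,
      (gradSq v x / 2 + W (1 - normSq (v x)) / (2 * ε ^ 2))
        - (gradSq u x / 2 + W (1 - normSq (u x)) / (2 * ε ^ 2))
      = ((∑ j, (gradDotS (fun y => u y j) (fun y => v y j - u y j) x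
            - c x * u x j * (v x j - u x j)))
          + (∑ j, quadDensity c (fun y => v y j - u y j) x) / 2)
        + defect W ε c u v x / (2 * ε ^ 2) := by
    intro x hx
    have hd : ∀ j, fderiv ℝ (fun x => v x j - u x j) x
        = fderiv ℝ (fun y => v y j) x - fderiv ℝ (fun y => u y j) x := fun j =>
      (((contDiffOn_pi.1 hv.1 j).differentiableOn (by norm_num) |>.differentiableAt
        (isOpen_unitDisk.mem_nhds hx)).hasFDerivAt.sub ((hu.weakSol j).hasFDerivAt hx)).fderiv
    rw [gradSq_eq_sum hv.1 hx, gradSq_eq_sum hua.1 hx]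
    simp only [quadDensity, gradSqS, gradDotS, hd, defect, normSq, Fin.sum_univ_three,
      Fin.sum_univ_two, sub_apply]
    field_simp
    ring
  rw [setIntegral_congr_fun isOpen_unitDisk.measurableSet key, integral_add, integral_add,
    integral_finsetSum _ fun j _ => (hwk j).1, integral_div, integral_div,
    integral_finsetSum _ fun j _ => hq j]
  · simp only [fun j => (hwk j).2, Finset.sum_const_zero, zero_add]
  · exact integrable_finsetSum _ fun j _ => (hwk j).1
  · exact (integrable_finsetSum _ fun j _ => hq j).div_const 2
  · exact (integrable_finsetSum _ fun j _ => (hwk j).1).add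
      ((integrable_finsetSum _ fun j _ => hq j).div_const 2)
  · exact hD.div_const _

theorem integral_defect_nonneg (hW : ContDiffOn ℝ 1 W (Iic (1:ℝ)))
    (hWconv : StrictConvexOn ℝ (Iic (1:ℝ)) W) (hε : 0 < ε) (hu : CriticalMap W ε c u)
    (v : (Fin 2 → ℝ) → Fin 3 → ℝ) : 0 ≤ ∫ x in unitDisk, defect W ε c u v x :=
  setIntegral_nonneg isOpen_unitDisk.measurableSet fun _ hx => hu.defect_nonneg hW hWconv hε v hx

/-- A critical map is minimising as soon as the quadratic form of its coefficient is
nonnegative. -/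
theorem isMinimiser (hW : ContDiffOn ℝ 1 W (Iic (1:ℝ)))
    (hWconv : StrictConvexOn ℝ (Iic (1:ℝ)) W) (hε : 0 < ε) (hu : CriticalMap W ε c u)
    (hbd : EqOn u ubd (frontier unitDisk))
    (hQ : ∀ φ, H10S unitDisk φ → 0 ≤ ∫ x in unitDisk, quadDensity c φ x) :
    IsMinimiser W ε unitDisk ubd u := by
  refine ⟨hu.admissible hbd, fun v hv => ?_⟩
  have h := hu.energy_sub hW hε hbd hv
  have h1 : 0 ≤ (∑ j, ∫ x in unitDisk, quadDensity c (fun y => v y j - u y j) x) / 2 :=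
    div_nonneg (Finset.sum_nonneg fun j _ => hQ _ (hu.h10S_sub hbd hv j)) zero_le_two
  have h2 : 0 ≤ (∫ x in unitDisk, defect W ε c u v x) / (2 * ε ^ 2) :=
    div_nonneg (hu.integral_defect_nonneg hW hWconv hε v) (by positivity)
  linarith

/-- If the coefficient of a critical map admits a positive solution `g`, then every minimiser
differs from the map by a constant vector times `g` and has the same pointwise length. -/
theorem eq_add_of_isMinimiser (hW : ContDiffOn ℝ 1 W (Iic (1:ℝ)))
    (hWconv : StrictConvexOn ℝ (Iic (1:ℝ)) W) (hε : 0 < ε) (hu : CriticalMap W ε c u)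
    (hbd : EqOn u ubd (frontier unitDisk)) {g : (Fin 2 → ℝ) → ℝ} (hg : WeakSol c g)
    (hpos : ∀ x ∈ unitDisk, 0 < g x) (hv : IsMinimiser W ε unitDisk ubd v) :
    ∃ a : Fin 3 → ℝ, ∀ x ∈ unitDisk,
      (∀ j, v x j = u x j + a j * g x) ∧ normSq (v x) = normSq (u x) := by
  have hw := hu.h10S_sub hbd hv.1
  have h := hu.energy_sub hW hε hbd hv.1
  have hQ := fun j => hg.integral_quadDensity_nonneg hpos (hw j)
  have hsum : 0 ≤ ∑ j, ∫ x in unitDisk, quadDensity c (fun y => v y j - u y j) x :=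
    Finset.sum_nonneg fun j _ => hQ j
  have hDn := hu.integral_defect_nonneg hW hWconv hε v
  have hDn' : 0 ≤ (∫ x in unitDisk, defect W ε c u v x) / (2 * ε ^ 2) :=
    div_nonneg hDn (by positivity)
  have hmin := hv.2 u (hu.admissible hbd)
  have hsum0 : ∑ j, ∫ x in unitDisk, quadDensity c (fun y => v y j - u y j) x = 0 := by linarith
  have hD0 : ∫ x in unitDisk, defect W ε c u v x = 0 := by
    have h0 : (∫ x in unitDisk, defect W ε c u v x) / (2 * ε ^ 2) = 0 := by linarith
    exact (div_eq_zero_iff.1 h0).resolve_right (by positivity)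
  have hDc := hu.continuousOn_defect hW hv.1.2.1
  have hae := (setIntegral_eq_zero_iff_of_nonneg_ae
    ((ae_restrict_mem isOpen_unitDisk.measurableSet).mono fun x hx =>
      hu.defect_nonneg hW hWconv hε v hx) (integrableOn_of_continuousOn_closure hDc)).1 hD0
  have hD := Measure.eqOn_open_of_ae_eq hae isOpen_unitDisk (hDc.mono subset_closure)
    continuousOn_const
  have ha : ∀ j, ∃ a, ∀ x ∈ unitDisk, v x j - u x j = a * g x := fun j =>
    hg.eq_const_mul_of_integral_eq_zero hpos (hw j)
      ((Finset.sum_eq_zero_iff_of_nonneg fun j _ => hQ j).1 hsum0 j (Finset.mem_univ j))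
  choose a ha using ha
  refine ⟨a, fun x hx => ⟨fun j => by linarith [ha j x hx], ?_⟩⟩
  by_contra hne
  exact (hu.defect_pos hW hWconv hε hx hne).ne' (hD hx)

end CriticalMap

/-- The coefficient `ε⁻² W'(1 - f² - g²)` of the radial system. -/
def radialCoeff (W : ℝ → ℝ) (ε : ℝ) (f g : ℝ → ℝ) (r : ℝ) : ℝ :=
  1 / ε ^ 2 * Wd W (1 - f r ^ 2 - g r ^ 2)

theorem toComplex_pow (m : ℕ) (x : Fin 2 → ℝ) :
    toComplex x ^ m = ((rad x ^ m : ℝ) : ℂ) *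
      ((Real.cos (m * (toComplex x).arg) : ℝ) + (Real.sin (m * (toComplex x).arg) : ℝ) * Complex.I) := by
  conv_lhs => rw [← Complex.norm_mul_exp_arg_mul_I (toComplex x), norm_toComplex]
  rw [mul_pow, ← Complex.exp_nat_mul, Complex.ofReal_pow, ← mul_assoc, ← Complex.ofReal_natCast,
    ← Complex.ofReal_mul, Complex.exp_mul_I, ← Complex.ofReal_cos, ← Complex.ofReal_sin]

theorem radialMap_zero_eq_planar {f : ℝ → ℝ} (hf : f 0 = 0) (k : ℤ) (g : ℝ → ℝ) (s : ℝ)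
    (x : Fin 2 → ℝ) : radialMap k f g s x 0 = planar k.natAbs f 1 x := by
  have hcos : Real.cos ((k.natAbs : ℝ) * (toComplex x).arg)
      = Real.cos (k * (toComplex x).arg) := by
    rcases Int.natAbs_eq k with h | h
    · rw [h]; simp
    · conv_rhs => rw [h]
      rw [Int.cast_neg, neg_mul, Real.cos_neg, Int.cast_natCast]
  change f (rad x) * Real.cos (k * (toComplex x).arg) = _
  rcases eq_or_ne x 0 with rfl | hx
  · simp [planar, hf]
  · have hr := (pow_pos (rad_pos hx) k.natAbs).ne'
    rw [planar, harm, toComplex_pow, hcos, one_mul, Complex.re_ofReal_mul]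
    simp only [Complex.add_re, Complex.ofReal_re, Complex.re_ofReal_mul, Complex.I_re, mul_zero,
      add_zero]
    field_simp

theorem radialMap_one_eq_planar {f : ℝ → ℝ} (hf : f 0 = 0) {k : ℤ} (hk : k ≠ 0) (g : ℝ → ℝ)
    (s : ℝ) (x : Fin 2 → ℝ) :
    radialMap k f g s x 1 = planar k.natAbs f (-((k.sign : ℝ) : ℂ) * Complex.I) x := by
  have hsin : k.sign * Real.sin ((k.natAbs : ℝ) * (toComplex x).arg)
      = Real.sin (k * (toComplex x).arg) := by
    have hkk : (k : ℝ) = k.sign * k.natAbs := by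
      rw [← Int.cast_natCast, ← Int.cast_mul, Int.sign_mul_natAbs]
    rw [hkk]
    rcases lt_or_gt_of_ne hk with h | h
    · simp [Int.sign_eq_neg_one_of_neg h]
    · simp [Int.sign_eq_one_of_pos h]
  change f (rad x) * Real.sin (k * (toComplex x).arg) = _
  rcases eq_or_ne x 0 with rfl | hx
  · simp [planar, hf]
  · have hr := (pow_pos (rad_pos hx) k.natAbs).ne'
    rw [planar, harm, toComplex_pow, ← hsin]
    have e : ∀ a b σ R : ℝ, (-(σ : ℂ) * Complex.I * ((R : ℂ) * ((a : ℂ) + (b : ℂ) * Complex.I))).re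
        = R * (σ * b) := fun a b σ R => by
      simp
      ring
    rw [e]
    field_simp

theorem radialMap_two_eq_planar (k : ℤ) (f g : ℝ → ℝ) (s : ℝ) (x : Fin 2 → ℝ) :
    radialMap k f g s x 2 = planar 0 g s x := by
  change s * g (rad x) = _
  simp [planar, harm, mul_comm]

theorem normSq_radialMap (k : ℤ) (f g : ℝ → ℝ) {s : ℝ} (hs : s ^ 2 = 1) (x : Fin 2 → ℝ) :
    normSq (radialMap k f g s x) = f (rad x) ^ 2 + g (rad x) ^ 2 := by
  have h := Real.sin_sq_add_cos_sq ((k : ℝ) * (toComplex x).arg)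
  have e : normSq (radialMap k f g s x) = (f (rad x) * Real.cos (k * (toComplex x).arg)) ^ 2
      + (f (rad x) * Real.sin (k * (toComplex x).arg)) ^ 2 + (s * g (rad x)) ^ 2 := by
    rw [normSq, Fin.sum_univ_three]; rfl
  rw [e]
  linear_combination f (rad x) ^ 2 * h + g (rad x) ^ 2 * hs

namespace SolvesSystem

variable {W : ℝ → ℝ} {ε : ℝ} {k : ℤ} {f g : ℝ → ℝ}

theorem continuousOn_radialCoeff (hW : ContDiffOn ℝ 1 W (Iic (1:ℝ)))
    (h : SolvesSystem W ε k f g) : ContinuousOn (radialCoeff W ε f g) (Icc 0 1) := by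
  refine continuousOn_const.mul ((continuousOn_Wd hW).comp
    ((continuousOn_const.sub (h.1.pow 2)).sub (h.2.1.pow 2)) fun r _ => ?_)
  simp only [mem_Iic]
  nlinarith [sq_nonneg (f r), sq_nonneg (g r)]

theorem radialODE_fst (hW : ContDiffOn ℝ 1 W (Iic (1:ℝ))) (h : SolvesSystem W ε k f g) :
    RadialODE k.natAbs (radialCoeff W ε f g) f := by
  have hc := continuousOn_radialCoeff hW h
  obtain ⟨hf, -, hf2, -, hode, -, hf0, -⟩ := h
  refine ⟨hf, hc, hf2, fun r hr => ?_, fun _ => hf0⟩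
  have hk : ((k.natAbs : ℕ) : ℝ) ^ 2 = (k : ℝ) ^ 2 := by
    rw [← Int.cast_natCast, ← Int.cast_pow, Int.natAbs_sq, Int.cast_pow]
  rw [hk, hode r hr, radialCoeff]
  ring

theorem radialODE_snd (hW : ContDiffOn ℝ 1 W (Iic (1:ℝ))) (h : SolvesSystem W ε k f g) :
    RadialODE 0 (radialCoeff W ε f g) g := by
  have hc := continuousOn_radialCoeff hW h
  obtain ⟨-, hg, -, hg2, -, hode, -⟩ := h
  refine ⟨hg, hc, hg2, fun r hr => ?_, fun h => absurd rfl h⟩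
  have := hode r hr
  rw [radialCoeff]
  simp only [Nat.cast_zero]
  linear_combination this

theorem criticalMap (hW : ContDiffOn ℝ 1 W (Iic (1:ℝ))) (hk : k ≠ 0)
    (h : SolvesSystem W ε k f g) {s : ℝ} (hs : s ^ 2 = 1) :
    CriticalMap W ε (fun x => radialCoeff W ε f g (rad x)) (radialMap k f g s) := by
  have hf0 : f 0 = 0 := h.2.2.2.2.2.2.1
  refine ⟨fun j => ?_, fun x _ => ?_⟩
  · fin_cases j
    · exact (funext (radialMap_zero_eq_planar hf0 k g s)) ▸ (radialODE_fst hW h).weakSol 1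
    · exact (funext (radialMap_one_eq_planar hf0 hk g s)) ▸
        (radialODE_fst hW h).weakSol (-((k.sign : ℝ) : ℂ) * Complex.I)
    · exact (funext (radialMap_two_eq_planar k f g s)) ▸ (radialODE_snd hW h).weakSol s
  · rw [normSq_radialMap k f g hs, radialCoeff]
    ring_nf

theorem eqOn_frontier (h : SolvesSystem W ε k f g) (s : ℝ) :
    EqOn (radialMap k f g s) (ubdDeg k) (frontier unitDisk) := fun x hx => by
  have hr : Real.sqrt (normSq x) = 1 := rad_eq_one_of_mem_frontier hx
  obtain ⟨-, -, -, -, -, -, -, hf1, -, hg1⟩ := h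
  simp [radialMap, ubdDeg, hr, hf1, hg1]

theorem weakSol_snd (hW : ContDiffOn ℝ 1 W (Iic (1:ℝ))) (h : SolvesSystem W ε k f g) :
    WeakSol (fun x => radialCoeff W ε f g (rad x)) fun x => g (rad x) := by
  have e : (fun x => g (rad x)) = planar 0 g 1 := by
    funext x; simp [planar, harm]
  rw [e]
  exact (radialODE_snd hW h).weakSol 1

theorem pos_rad (hW : ContDiffOn ℝ 1 W (Iic (1:ℝ))) (h : SolvesSystem W ε k f g)
    (hpos : ∀ r ∈ Ioo (0:ℝ) 1, 0 < g r) : ∀ x ∈ unitDisk, 0 < g (rad x) := fun x hx => by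
  rcases eq_or_ne x 0 with rfl | hx0
  · rw [rad_zero]
    exact (radialODE_snd hW h).pos_zero hpos
  · exact hpos _ ⟨rad_pos hx0, mem_unitDisk_iff.1 hx⟩

end SolvesSystem

theorem rad_polar {r : ℝ} (hr : 0 ≤ r) (θ : ℝ) : rad ![r * Real.cos θ, r * Real.sin θ] = r := by
  rw [← abs_of_nonneg hr, ← abs_of_nonneg (rad_nonneg _), ← sq_eq_sq_iff_abs_eq_abs, rad_sq,
    abs_of_nonneg hr]
  simp
  linear_combination r ^ 2 * Real.sin_sq_add_cos_sq θ

theorem radialMap_polar (k : ℤ) (f g : ℝ → ℝ) (s : ℝ) {r θ : ℝ} (hr : 0 < r)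
    (hθ : θ ∈ Ioc (-Real.pi) Real.pi) :
    radialMap k f g s ![r * Real.cos θ, r * Real.sin θ]
      = ![f r * Real.cos (k * θ), f r * Real.sin (k * θ), s * g r] := by
  have h1 : Real.sqrt (normSq ![r * Real.cos θ, r * Real.sin θ]) = r := rad_polar hr.le θ
  have h2 : Complex.arg (((r * Real.cos θ : ℝ) : ℂ) + ((r * Real.sin θ : ℝ) : ℂ) * Complex.I)
      = θ := by
    have := Complex.arg_mul_cos_add_sin_mul_I hr hθ
    convert this using 2
    push_cast
    ring
  rw [radialMap, h1]
  simp only [Matrix.cons_val_zero, Matrix.cons_val_one, h2]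

namespace SolvesSystem

variable {W : ℝ → ℝ} {ε : ℝ} {k : ℤ} {f g : ℝ → ℝ}

theorem exists_ne_zero (h : SolvesSystem W ε k f g) : ∃ r ∈ Ioo (0:ℝ) 1, f r ≠ 0 := by
  obtain ⟨hf, -, -, -, -, -, -, hf1, -⟩ := h
  by_contra! hz
  have h1 : EqOn f 0 (Icc (0:ℝ) 1) :=
    EqOn.of_subset_closure hz hf continuousOn_const Ioo_subset_Icc_self
      (closure_Ioo zero_ne_one).ge
  have := h1 (right_mem_Icc.2 zero_le_one)
  rw [hf1] at this
  exact one_ne_zero this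

theorem exists_neg_of_not_isMinimiser (hW : ContDiffOn ℝ 1 W (Iic (1:ℝ)))
    (hWconv : StrictConvexOn ℝ (Iic (1:ℝ)) W) (hε : 0 < ε) (hk : k ≠ 0)
    (h : SolvesSystem W ε k f g) (hnot : ¬ IsMinimiser W ε unitDisk (ubdDeg k) (radialMap k f g 1)) :
    ∃ φ : (Fin 2 → ℝ) → ℝ, H10S unitDisk φ ∧
      (∫ x in unitDisk,
        (gradSqS φ x - 1 / ε ^ 2 * Wd W (1 - normSq (radialMap k f g 1 x)) * φ x ^ 2)) < 0 := by
  by_contra! hcon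
  have hcm := criticalMap hW hk h (one_pow 2)
  refine hnot (hcm.isMinimiser hW hWconv hε (h.eqOn_frontier 1) fun φ hφ => ?_)
  refine (hcon φ hφ).trans (le_of_eq ?_)
  refine setIntegral_congr_fun isOpen_unitDisk.measurableSet fun x hx => ?_
  simp only [quadDensity]
  rw [← hcm.coeff_eq x hx]

theorem isMinimiser (hW : ContDiffOn ℝ 1 W (Iic (1:ℝ)))
    (hWconv : StrictConvexOn ℝ (Iic (1:ℝ)) W) (hε : 0 < ε) (hk : k ≠ 0)
    (h : SolvesSystem W ε k f g) (hpos : ∀ r ∈ Ioo (0:ℝ) 1, 0 < g r) {s : ℝ} (hs : s ^ 2 = 1) :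
    IsMinimiser W ε unitDisk (ubdDeg k) (radialMap k f g s) :=
  (criticalMap hW hk h hs).isMinimiser hW hWconv hε (h.eqOn_frontier s) fun _ hφ =>
    (weakSol_snd hW h).integral_quadDensity_nonneg (pos_rad hW h hpos) hφ

theorem eqOn_of_isMinimiser (hW : ContDiffOn ℝ 1 W (Iic (1:ℝ)))
    (hWconv : StrictConvexOn ℝ (Iic (1:ℝ)) W) (hε : 0 < ε) (hk : k ≠ 0)
    (h : SolvesSystem W ε k f g) (hpos : ∀ r ∈ Ioo (0:ℝ) 1, 0 < g r)
    {v : (Fin 2 → ℝ) → Fin 3 → ℝ} (hv : IsMinimiser W ε unitDisk (ubdDeg k) v) :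
    EqOn v (radialMap k f g 1) unitDisk ∨ EqOn v (radialMap k f g (-1)) unitDisk := by
  obtain ⟨a, ha⟩ := (criticalMap hW hk h (one_pow 2)).eq_add_of_isMinimiser hW hWconv hε
    (h.eqOn_frontier 1) (weakSol_snd hW h) (pos_rad hW h hpos) hv
  obtain ⟨r, hr, hfr⟩ := h.exists_ne_zero
  have hgr := hpos r hr
  have key : ∀ θ ∈ Ioc (-Real.pi) Real.pi,
      2 * f r * (a 0 * Real.cos (k * θ) + a 1 * Real.sin (k * θ))
        + g r * (2 * a 2 + (a 0 ^ 2 + a 1 ^ 2 + a 2 ^ 2)) = 0 := fun θ hθ => by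
    have hx : ![r * Real.cos θ, r * Real.sin θ] ∈ unitDisk :=
      mem_unitDisk_iff.2 (by rw [rad_polar hr.1.le]; exact hr.2)
    obtain ⟨h1, h2⟩ := ha _ hx
    simp only [normSq, h1, rad_polar hr.1.le, radialMap_polar k f g 1 hr.1 hθ,
      Fin.sum_univ_three] at h2
    simp at h2
    refine mul_left_cancel₀ hgr.ne' ?_
    linear_combination h2
  have hkpos : (1:ℝ) ≤ |(k : ℝ)| := by exact_mod_cast Int.one_le_abs hk
  have hk0 : (0:ℝ) < |(k : ℝ)| := by linarith
  have hpi := Real.pi_pos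
  have hle : Real.pi / |(k : ℝ)| ≤ Real.pi := div_le_self hpi.le hkpos
  have hp : 0 < Real.pi / |(k : ℝ)| := by positivity
  have abs_eq : ∀ t : ℝ, 0 ≤ t → |(k : ℝ) * (t / |(k : ℝ)|)| = t := fun t ht => by
    rw [abs_mul, abs_div, abs_abs, abs_of_nonneg ht]
    field_simp
  have hcos : ∀ t : ℝ, 0 ≤ t → Real.cos ((k : ℝ) * (t / |(k : ℝ)|)) = Real.cos t := fun t ht => by
    rw [← Real.cos_abs, abs_eq t ht]
  have hsin : ∀ t : ℝ, 0 ≤ t → Real.sin ((k : ℝ) * (t / |(k : ℝ)|)) ^ 2 = Real.sin t ^ 2 :=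
    fun t ht => by rw [Real.sin_sq, Real.sin_sq, hcos t ht]
  have k0 := key 0 ⟨by linarith, hpi.le⟩
  have k1 := key (Real.pi / |(k : ℝ)|) ⟨by linarith, hle⟩
  have k2 := key (Real.pi / 2 / |(k : ℝ)|)
    ⟨lt_trans (neg_lt_zero.2 hpi) (by positivity), by
      rw [div_right_comm]; linarith⟩
  rw [hcos _ hpi.le, show Real.sin ((k : ℝ) * (Real.pi / |(k : ℝ)|)) = 0 by
    have := hsin _ hpi.le
    rw [Real.sin_pi] at this
    simpa using this, Real.cos_pi] at k1
  rw [hcos _ (by positivity), Real.cos_pi_div_two] at k2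
  have hs2 := hsin (Real.pi / 2) (by positivity)
  rw [Real.sin_pi_div_two, one_pow] at hs2
  simp only [mul_zero, Real.cos_zero, Real.sin_zero, mul_one, add_zero, zero_add] at k0 k1 k2
  have ha0 : a 0 = 0 := by
    refine (mul_eq_zero.1 (?_ : (4 * f r) * a 0 = 0)).resolve_left (by simpa using hfr)
    linear_combination k0 - k1
  have hC : 2 * a 2 + (a 0 ^ 2 + a 1 ^ 2 + a 2 ^ 2) = 0 := by
    refine (mul_eq_zero.1 (?_ : g r * _ = 0)).resolve_left hgr.ne'
    rw [ha0] at k0 ⊢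
    linear_combination k0
  have ha1 : a 1 = 0 := by
    rw [hC] at k2
    refine (mul_eq_zero.1 (?_ : (2 * f r) * a 1 = 0)).resolve_left (by simpa using hfr)
    linear_combination Real.sin (k * (Real.pi / 2 / |(k : ℝ)|)) * k2 - 2 * f r * a 1 * hs2
  rw [ha0, ha1] at hC
  have ha2 : a 2 = 0 ∨ a 2 = -2 := by
    rcases mul_eq_zero.1 (show a 2 * (a 2 + 2) = 0 by linear_combination hC) with h | h
    · exact Or.inl h
    · exact Or.inr (by linarith)
  rcases ha2 with ha2 | ha2
  · refine Or.inl fun x hx => ?_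
    ext j
    rw [(ha x hx).1 j]
    fin_cases j <;> simp [ha0, ha1, ha2]
  · refine Or.inr fun x hx => ?_
    ext j
    rw [(ha x hx).1 j]
    fin_cases j <;> simp [ha0, ha1, ha2, radialMap, rad]
    ring

end SolvesSystem

end

/-- Theorem 1.1(4): for `ε ∈ (0, ε_k)` the energy `E_ε` has exactly the two
minimisers given by `(f_ε, ± g_ε)` with `g_ε > 0`, and the critical point corresponding to
`(f̃_ε, g̃_ε ≡ 0)` is unstable. -/
theorem statement_3
    (W : ℝ → ℝ) (hW : ContDiffOn ℝ 1 W (Iic (1:ℝ))) (hW0 : W 0 = 0)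
    (hWpos : ∀ t ∈ Iic (1:ℝ), t ≠ 0 → 0 < W t)
    (hWconv : StrictConvexOn ℝ (Iic (1:ℝ)) W)
    (k : ℤ) (hk : k ≠ 0)
    (εk : ℝ) (hεk : 0 < εk)
    (hdich : ∀ ε : ℝ, 0 < ε →
      ((∃ f g : ℝ → ℝ, SolvesSystem W ε k f g ∧ ∀ r ∈ Ioo (0:ℝ) 1, 0 < g r) ↔ ε < εk))
    (ε : ℝ) (hε : 0 < ε) (hεlt : ε < εk) :
    ∃ f g : ℝ → ℝ, SolvesSystem W ε k f g ∧ (∀ r ∈ Ioo (0:ℝ) 1, 0 < g r) ∧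
      IsMinimiser W ε unitDisk (ubdDeg k) (radialMap k f g 1) ∧
      IsMinimiser W ε unitDisk (ubdDeg k) (radialMap k f g (-1)) ∧
      ¬ EqOn (radialMap k f g 1) (radialMap k f g (-1)) unitDisk ∧
      (∀ v, IsMinimiser W ε unitDisk (ubdDeg k) v →
        EqOn v (radialMap k f g 1) unitDisk ∨ EqOn v (radialMap k f g (-1)) unitDisk) ∧
      (∀ ft gt : ℝ → ℝ, SolvesSystem W ε k ft gt → (∀ r ∈ Ioo (0:ℝ) 1, 0 < ft r) →
        (∀ r ∈ Icc (0:ℝ) 1, gt r = 0) →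
        ∃ φ : (Fin 2 → ℝ) → ℝ, H10S unitDisk φ ∧
          (∫ x in unitDisk,
            (gradSqS φ x - 1 / ε ^ 2 * Wd W (1 - normSq (radialMap k ft gt 1 x)) * φ x ^ 2))
            < 0) := by
  obtain ⟨f, g, hs, hpos⟩ := (hdich ε hε).2 hεlt
  have hunique := fun v => hs.eqOn_of_isMinimiser (v := v) hW hWconv hε hk hpos
  have hhalf : (![1 / 2, 0] : Fin 2 → ℝ) ∈ unitDisk := by
    simp [unitDisk]; norm_num
  have hrad : Real.sqrt (normSq (![1 / 2, 0] : Fin 2 → ℝ)) = 1 / 2 := by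
    rw [normSq_two]
    simp
  have hghalf := hpos (1 / 2) ⟨by norm_num, by norm_num⟩
  have hthird : ∀ (f g : ℝ → ℝ) (s : ℝ), radialMap k f g s ![1 / 2, 0] 2 = s * g (1 / 2) :=
    fun f g s => by
      change s * g (Real.sqrt (normSq (![1 / 2, 0] : Fin 2 → ℝ))) = _
      rw [hrad]
  refine ⟨f, g, hs, hpos, hs.isMinimiser hW hWconv hε hk hpos (by norm_num),
    hs.isMinimiser hW hWconv hε hk hpos (by norm_num), fun heq => ?_, hunique, ?_⟩
  · have h := congrFun (heq hhalf) 2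
    rw [hthird, hthird] at h
    linarith
  · intro ft gt hst _ hgt
    refine hst.exists_neg_of_not_isMinimiser hW hWconv hε hk fun hmin => ?_
    have hz := hgt (1 / 2) ⟨by norm_num, by norm_num⟩
    rcases hunique _ hmin with heq | heq
    · have h := congrFun (heq hhalf) 2
      rw [hthird, hthird, hz] at h
      linarith
    · have h := congrFun (heq hhalf) 2
      rw [hthird, hthird, hz] at h
      linarith
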